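/- Let F be a free group of countably infinite rank, let t be a primitive element of F, and let ψ ∈ Aut(F) be an extremal involution which inverts t. Then the image in Out(F) of the pointwise stabilizer Γ_(t) = {σ ∈ Aut(F) : σt = t} is the least subgroup of Out(F) of index strictly less than 2^ℵ₀ which contains the commutator subgroup of the centralizer of ψ̂ in Out(F). -/

import Mathlib

open Pointwise

/-- A subset `S` of a free group is a basis if the canonical homomorphism
`FreeGroup S →* FreeGroup X` extending the inclusion is bijective. -/
def FreeGroup.IsBasis {X : Type*} (S : Set (FreeGroup X)) : Prop :=
  Function.Bijective (FreeGroup.lift (fun s : S => (s : FreeGroup X)))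

/-- The subgroup of inner automorphisms of a group `G`, as a subgroup of `MulAut G`. -/
def Inn (G : Type*) [Group G] : Subgroup (MulAut G) :=
  (MulAut.conj : G →* MulAut G).range

instance Inn.normal (G : Type*) [Group G] : (Inn G).Normal := by
  constructor
  rintro - ⟨g, rfl⟩ σ
  refine ⟨σ g, ?_⟩
  ext x
  simp [MulAut.conj, MulAut.mul_apply, mul_assoc]

/-- The outer automorphism group `Out G = Aut G / Inn G`. -/
abbrev OutAut (G : Type*) [Group G] := MulAut G ⧸ Inn G

/-- The natural homomorphism `Aut G → Out G`. -/
def toOut {G : Type*} [Group G] : MulAut G →* OutAut G :=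
  QuotientGroup.mk' (Inn G)

/-- `g` is an involution of the group `G`. -/
def IsInvolution {G : Type*} [Group G] (g : G) : Prop :=
  g ≠ 1 ∧ g ^ 2 = 1

/-- A subset of a group is anti-commutative if its elements pairwise do not commute. -/
def AntiCommSet {G : Type*} [Group G] (s : Set G) : Prop :=
  ∀ a ∈ s, ∀ b ∈ s, a ≠ b → a * b ≠ b * a

/-- A decomposition `U ⊔ S ⊔ ⊔_{x ∈ S} Y x` of a basis of a free group. -/
structure IsBasisDecomposition {X : Type*} (U S : Set (FreeGroup X))
    (Y : FreeGroup X → Set (FreeGroup X)) : Prop where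
  isBasis : FreeGroup.IsBasis (U ∪ S ∪ ⋃ x ∈ S, Y x)
  disjUS : Disjoint U S
  disjUY : ∀ x ∈ S, Disjoint U (Y x)
  disjSY : ∀ x ∈ S, Disjoint S (Y x)
  disjYY : ∀ x ∈ S, ∀ x' ∈ S, x ≠ x' → Disjoint (Y x) (Y x')

/-- `U ⊔ S ⊔ ⊔_{x ∈ S} Y x` is a canonical basis for the (soft) involution `φ`:
`φ` fixes `U` pointwise, inverts the elements of `S` and conjugates the elements of
`Y x` by `x`. -/
def IsCanonicalBasis {X : Type*} (φ : MulAut (FreeGroup X)) (U S : Set (FreeGroup X))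
    (Y : FreeGroup X → Set (FreeGroup X)) : Prop :=
  IsBasisDecomposition U S Y ∧
    (∀ u ∈ U, φ u = u) ∧ (∀ x ∈ S, φ x = x⁻¹) ∧
    (∀ x ∈ S, ∀ y ∈ Y x, φ y = x * y * x⁻¹)

/-- A soft involution of `Aut F`: an involution admitting a canonical basis. -/
def IsSoftInvolution {X : Type*} (φ : MulAut (FreeGroup X)) : Prop :=
  IsInvolution φ ∧ ∃ U S Y, IsCanonicalBasis φ U S Y

/-- A soft involution of `Out F`: an involution induced by a soft involution of `Aut F`. -/
def IsSoftOutInvolution {X : Type*} (f : OutAut (FreeGroup X)) : Prop :=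
  IsInvolution f ∧ ∃ φ, IsSoftInvolution φ ∧ toOut φ = f

/-- A `1`-involution of `Aut F`: a soft involution whose canonical bases have exactly
one block. -/
def IsOneInvolution {X : Type*} (ψ : MulAut (FreeGroup X)) : Prop :=
  IsInvolution ψ ∧ ∃ (U Y : Set (FreeGroup X)) (x : FreeGroup X),
    IsCanonicalBasis ψ U {x} (fun _ => Y)

/-- A `1`-involution of `Out F`: an involution induced by a `1`-involution of `Aut F`. -/
def IsOneOutInvolution {X : Type*} (f : OutAut (FreeGroup X)) : Prop :=
  IsInvolution f ∧ ∃ ψ, IsOneInvolution ψ ∧ toOut ψ = f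

/-- An extremal involution of `Aut F`: an involution inverting one element of a suitable
basis and fixing all other elements of that basis. -/
def IsExtremalInvolution {X : Type*} (φ : MulAut (FreeGroup X)) : Prop :=
  IsInvolution φ ∧ ∃ (B : Set (FreeGroup X)) (x : FreeGroup X),
    FreeGroup.IsBasis B ∧ x ∈ B ∧ φ x = x⁻¹ ∧ ∀ b ∈ B, b ≠ x → φ b = b

/-- An extremal involution of `Out F`: an involution induced by an extremal involution
of `Aut F`. -/
def IsExtremalOutInvolution {X : Type*} (f : OutAut (FreeGroup X)) : Prop :=
  IsInvolution f ∧ ∃ φ, IsExtremalInvolution φ ∧ toOut φ = f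

/-- A symmetry of `Aut F`: an involution inverting all elements of some basis. -/
def IsSymmetryAut {X : Type*} (θ : MulAut (FreeGroup X)) : Prop :=
  IsInvolution θ ∧ ∃ B : Set (FreeGroup X), FreeGroup.IsBasis B ∧ ∀ b ∈ B, θ b = b⁻¹

/-- A symmetry of `Out F`: an involution whose full preimage in `Aut F` contains a
symmetry. -/
def IsSymmetryOut {X : Type*} (f : OutAut (FreeGroup X)) : Prop :=
  IsInvolution f ∧ ∃ θ, IsSymmetryAut θ ∧ toOut θ = f

/-- Condition (★): the product set `K·K` contains exactly one conjugacy class of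
involutions, and no element of `K` is a square. -/
def StarCondition {G : Type*} [Group G] (K : Set G) : Prop :=
  (∃ c ∈ K * K, IsInvolution c ∧ ∀ d ∈ K * K, IsInvolution d → IsConj c d) ∧
    ∀ k ∈ K, ¬ ∃ g : G, g ^ 2 = k

section GenericTuples

open Topology Filter Function

/-- A neighbourhood basis of open subgroups `U n`, each normalized by a subgroup `P n`, such that
finitary elements (those in `P m`) approximate every element and any two of them agreeing
modulo `U n` can be amalgamated, the whole being complete for the two-sided uniformity. -/
structure AmalgamationChain {G : Type*} [Group G] [TopologicalSpace G]
    (U P : ℕ → Subgroup G) : Prop where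
  anti : Antitone U
  isOpen : ∀ n, IsOpen (U n : Set G)
  basis : ∀ s ∈ 𝓝 (1 : G), ∃ n, (U n : Set G) ⊆ s
  le : ∀ n, U n ≤ P n
  normalizes : ∀ n, ∀ p ∈ P n, ∀ u ∈ U n, p * u * p⁻¹ ∈ U n
  countable : ∀ n, Countable (G ⧸ U n)
  approx : ∀ (x : G) (r : ℕ), ∃ L, r ≤ L ∧ ∀ m, L ≤ m → ∃ q ∈ P m, q⁻¹ * x ∈ U r
  amalg : ∀ n m l, n ≤ m → n ≤ l → ∃ N, l ≤ N ∧ ∃ s ∈ U n, (∀ x ∈ U N, s⁻¹ * x * s ∈ U m) ∧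
    ∀ θ ∈ P n, θ ∈ P m → ∀ a ∈ P n, a ∈ P l → θ⁻¹ * a ∈ U n →
      ∃ θ' ∈ P l, θ' ∈ P N ∧ θ'⁻¹ * a ∈ U l ∧ θ⁻¹ * (s⁻¹ * θ' * s) ∈ U m
  complete : ∀ κ : ℕ → G,
    (∀ r, ∀ᶠ j in atTop, (κ j)⁻¹ * κ (j + 1) ∈ U r ∧ κ j * (κ (j + 1))⁻¹ ∈ U r) →
      ∃ k, ∀ r, ∀ᶠ j in atTop, (κ j)⁻¹ * k ∈ U r

/-- The tuple `a 0, …, a (j - 1)` is generic with respect to the chain. -/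
structure IsGenericTuple {G : Type*} [Group G] (U P : ℕ → Subgroup G) (j : ℕ) (a : ℕ → G) :
    Prop where
  finitary : ∀ (g : G) (l : ℕ), ∃ m, l ≤ m ∧ ∃ h, g⁻¹ * h ∈ U l ∧ ∀ i < j, h⁻¹ * a i * h ∈ P m
  extension : ∀ n m, n ≤ m → ∀ (g : G) (θ : ℕ → G),
    (∀ i < j, θ i ∈ P n ∧ θ i ∈ P m ∧ (θ i)⁻¹ * (g⁻¹ * a i * g) ∈ U n) →
      ∃ h, g⁻¹ * h ∈ U n ∧ ∀ i < j, (θ i)⁻¹ * (h⁻¹ * a i * h) ∈ U m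

theorem IsGenericTuple.zero {G : Type*} [Group G] {U P : ℕ → Subgroup G} (a : ℕ → G) :
    IsGenericTuple U P 0 a where
  finitary g l := ⟨l, le_rfl, g, by simp, by simp⟩
  extension n m _ g θ _ := ⟨g, by simp, by simp⟩

namespace AmalgamationChain

variable {G : Type*} [Group G] [TopologicalSpace G] {U P : ℕ → Subgroup G}

theorem normalizes' (hc : AmalgamationChain U P) {n : ℕ} {p u : G} (hp : p ∈ P n) (hu : u ∈ U n) :
    p⁻¹ * u * p ∈ U n := by
  simpa using hc.normalizes n p⁻¹ (inv_mem hp) u hu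

theorem isOpen_P [IsTopologicalGroup G] (hc : AmalgamationChain U P) (n : ℕ) :
    IsOpen (P n : Set G) :=
  Subgroup.isOpen_mono (hc.le n) (hc.isOpen n)

theorem exists_conj_le [IsTopologicalGroup G] (hc : AmalgamationChain U P) (g : G) (r : ℕ) :
    ∃ l, r ≤ l ∧ ∀ l', l ≤ l' → ∀ u ∈ U l', g * u * g⁻¹ ∈ U r := by
  have hcont : Continuous fun u : G => g * u * g⁻¹ := by fun_prop
  have : (fun u : G => g * u * g⁻¹) ⁻¹' (U r : Set G) ∈ 𝓝 (1 : G) :=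
    ((hc.isOpen r).preimage hcont).mem_nhds (by simp)
  obtain ⟨l, hl⟩ := hc.basis _ this
  refine ⟨max l r, le_max_right _ _, fun l' h u hu => hl ?_⟩
  exact hc.anti ((le_max_left _ _).trans h) hu

theorem exists_finitary_near [IsTopologicalGroup G] (hc : AmalgamationChain U P) {j : ℕ}
    {a : ℕ → G} (ha : IsGenericTuple U P j a) (g v : G) (l r : ℕ) :
    ∃ m, l ≤ m ∧ ∃ h u, v⁻¹ * u ∈ U r ∧ g⁻¹ * h ∈ U l ∧
      (∀ i < j, h⁻¹ * a i * h ∈ P m) ∧ h⁻¹ * u * h ∈ P m := by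
  obtain ⟨L₁, -, h₁⟩ := hc.approx g⁻¹ r
  obtain ⟨L₂, -, h₂⟩ := hc.approx (g⁻¹ * v) r
  obtain ⟨L₃, -, h₃⟩ := hc.exists_conj_le g r
  obtain ⟨L₄, -, h₄⟩ := hc.exists_conj_le (v⁻¹ * g) r
  set L := max l (max L₁ (max L₂ (max L₃ L₄))) with hL
  obtain ⟨m, hm, h, hgh, hh⟩ := ha.finitary g L
  obtain ⟨q₁, hq₁, hq₁'⟩ := h₁ m (by omega)
  obtain ⟨q₂, hq₂, hq₂'⟩ := h₂ m (by omega)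
  refine ⟨m, by omega, h, h * q₂ * q₁⁻¹ * h⁻¹, ?_, hc.anti (by omega) hgh, hh, ?_⟩
  · have e : v⁻¹ * (h * q₂ * q₁⁻¹ * h⁻¹) =
        (v⁻¹ * g * (g⁻¹ * h) * (v⁻¹ * g)⁻¹) * (q₂⁻¹ * (g⁻¹ * v))⁻¹ *
          ((q₁⁻¹ * g⁻¹) * (g * (g⁻¹ * h) * g⁻¹)⁻¹) := by group
    rw [e]
    exact mul_mem (mul_mem (h₄ L (by omega) _ hgh) (inv_mem hq₂'))
      (mul_mem hq₁' (inv_mem (h₃ L (by omega) _ hgh)))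
  · have e : h⁻¹ * (h * q₂ * q₁⁻¹ * h⁻¹) * h = q₂ * q₁⁻¹ := by group
    rw [e]
    exact mul_mem hq₂ (inv_mem hq₁)

theorem exists_extension_near [IsTopologicalGroup G] (hc : AmalgamationChain U P) {j : ℕ}
    {a : ℕ → G} (ha : IsGenericTuple U P j a) {n m : ℕ} (hnm : n ≤ m) (g v : G) (r : ℕ)
    (θ : ℕ → G) (hθ : ∀ i ≤ j, θ i ∈ P n ∧ θ i ∈ P m)
    (hθ' : ∀ i < j, (θ i)⁻¹ * (g⁻¹ * a i * g) ∈ U n) :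
    ∃ u, v⁻¹ * u ∈ U r ∧ ((θ j)⁻¹ * (g⁻¹ * u * g) ∈ U n → ∃ h, g⁻¹ * h ∈ U n ∧
      (∀ i < j, (θ i)⁻¹ * (h⁻¹ * a i * h) ∈ U m) ∧ (θ j)⁻¹ * (h⁻¹ * u * h) ∈ U m) := by
  obtain ⟨l, -, hl⟩ := hc.exists_conj_le g r
  obtain ⟨M, hM, h₀, v', hv', hgh, hPa, hPv⟩ :=
    hc.exists_finitary_near ha g v (max l n) r
  by_cases hprem : (θ j)⁻¹ * (g⁻¹ * v' * g) ∈ U n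
  swap
  · exact ⟨v', hv', fun h => absurd h hprem⟩
  obtain ⟨N, hN, s, hs, hsN, hamalg⟩ := hc.amalg n m M hnm (by omega)
  have hghn : g⁻¹ * h₀ ∈ U n := hc.anti (by omega) hgh
  have key : ∀ i ≤ j, ∀ b : G, h₀⁻¹ * b * h₀ ∈ P M → (θ i)⁻¹ * (g⁻¹ * b * g) ∈ U n →
      ∃ θ' ∈ P M, θ' ∈ P N ∧ θ'⁻¹ * (h₀⁻¹ * b * h₀) ∈ U M ∧
        (θ i)⁻¹ * (s⁻¹ * θ' * s) ∈ U m := by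
    intro i hi b hb hb'
    have e : (θ i)⁻¹ * (h₀⁻¹ * b * h₀) = ((θ i)⁻¹ * (g⁻¹ * h₀)⁻¹ * θ i) *
      ((θ i)⁻¹ * (g⁻¹ * b * g)) * (g⁻¹ * h₀) := by group
    have hmem : (θ i)⁻¹ * (h₀⁻¹ * b * h₀) ∈ U n := by
      rw [e]
      exact mul_mem (mul_mem (hc.normalizes' (hθ i hi).1 (inv_mem hghn)) hb') hghn
    refine hamalg (θ i) (hθ i hi).1 (hθ i hi).2 _ ?_ hb hmem
    have := mul_mem (hθ i hi).1 (hc.le n hmem)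
    simpa [mul_assoc] using this
  have key₁ : ∀ i, ∃ θ', i < j → (θ' ∈ P M ∧ θ' ∈ P N ∧ θ'⁻¹ * (h₀⁻¹ * a i * h₀) ∈ U M ∧
        (θ i)⁻¹ * (s⁻¹ * θ' * s) ∈ U m) := by
    intro i
    by_cases hi : i < j
    · obtain ⟨θ', h1, h2, h3, h4⟩ := key i hi.le (a i) (hPa i hi) (hθ' i hi)
      exact ⟨θ', fun _ => ⟨h1, h2, h3, h4⟩⟩
    · exact ⟨1, fun h => absurd h hi⟩
  choose θ' hθ'1 using key₁
  obtain ⟨ρ, hρ1, hρ2, hρ3, hρ4⟩ := key j le_rfl v' hPv hprem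
  obtain ⟨h, hh, hh'⟩ := ha.extension M N hN h₀ θ' fun i hi =>
    ⟨(hθ'1 i hi).1, (hθ'1 i hi).2.1, (hθ'1 i hi).2.2.1⟩
  refine ⟨h * ρ * h⁻¹, ?_, fun _ => ⟨h * s, ?_, fun i hi => ?_, ?_⟩⟩
  · have e : v⁻¹ * (h * ρ * h⁻¹) = (v⁻¹ * v') * (g * ((g⁻¹ * h₀) *
        (((h₀⁻¹ * v' * h₀)⁻¹ * (h₀⁻¹ * h) * (h₀⁻¹ * v' * h₀)) *
          (ρ⁻¹ * (h₀⁻¹ * v' * h₀))⁻¹ * (h₀⁻¹ * h)⁻¹) * (g⁻¹ * h₀)⁻¹) * g⁻¹) := by group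
    rw [e]
    refine mul_mem hv' (hl _ (le_max_left l n) _ (mul_mem (mul_mem hgh ?_) (inv_mem hgh)))
    exact hc.anti hM (mul_mem (mul_mem (hc.normalizes' hPv hh) (inv_mem hρ3)) (inv_mem hh))
  · have e : g⁻¹ * (h * s) = (g⁻¹ * h₀) * (h₀⁻¹ * h) * s := by group
    rw [e]
    exact mul_mem (mul_mem hghn (hc.anti (by omega) hh)) hs
  · have e : (θ i)⁻¹ * ((h * s)⁻¹ * a i * (h * s)) = ((θ i)⁻¹ * (s⁻¹ * θ' i * s)) *
      (s⁻¹ * ((θ' i)⁻¹ * (h⁻¹ * a i * h)) * s) := by group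
    rw [e]
    exact mul_mem (hθ'1 i hi).2.2.2 (hsN _ (hh' i hi))
  · have e : (θ j)⁻¹ * ((h * s)⁻¹ * (h * ρ * h⁻¹) * (h * s)) = (θ j)⁻¹ * (s⁻¹ * ρ * s) := by
      group
    rw [e]
    exact hρ4

theorem dense_of_forall_coset [IsTopologicalGroup G] (hc : AmalgamationChain U P) {D : Set G}
    (h : ∀ v r, ∃ u, v⁻¹ * u ∈ U r ∧ u ∈ D) : Dense D := by
  intro v
  rw [mem_closure_iff_nhds]
  intro W hW
  have : (fun u => v * u) ⁻¹' W ∈ 𝓝 (1 : G) :=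
    (continuous_const_mul v).continuousAt.preimage_mem_nhds (by simpa using hW)
  obtain ⟨r, hr⟩ := hc.basis _ this
  obtain ⟨u, hu, hu'⟩ := h v r
  exact ⟨u, by simpa using hr hu, hu'⟩

theorem isOpen_conj_mem [IsTopologicalGroup G] {V : Subgroup G} (hV : IsOpen (V : Set G))
    (c h : G) : IsOpen {u : G | c * (h⁻¹ * u * h) ∈ V} :=
  hV.preimage (by fun_prop : Continuous fun u : G => c * (h⁻¹ * u * h))

theorem eventually_isGenericTuple_update [IsTopologicalGroup G] (hc : AmalgamationChain U P)
    {j : ℕ} {a : ℕ → G} (ha : IsGenericTuple U P j a) :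
    ∀ᶠ u in residual G, IsGenericTuple U P (j + 1) (update a j u) := by
  have := hc.countable
  have hfin : ∀ᶠ u in residual G, ∀ (l : ℕ) (c : G ⧸ U l), ∃ m, l ≤ m ∧ ∃ h,
      c.out⁻¹ * h ∈ U l ∧ (∀ i < j, h⁻¹ * a i * h ∈ P m) ∧ h⁻¹ * u * h ∈ P m := by
    refine eventually_countable_forall.2 fun l => eventually_countable_forall.2 fun c => ?_
    refine residual_of_dense_open ?_ (hc.dense_of_forall_coset fun v r => ?_)
    · have : {u | ∃ m, l ≤ m ∧ ∃ h, c.out⁻¹ * h ∈ U l ∧ (∀ i < j, h⁻¹ * a i * h ∈ P m) ∧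
          h⁻¹ * u * h ∈ P m} = ⋃ (m : ℕ) (_ : l ≤ m) (h : G) (_ : c.out⁻¹ * h ∈ U l)
            (_ : ∀ i < j, h⁻¹ * a i * h ∈ P m), {u | 1 * (h⁻¹ * u * h) ∈ P m} := by
        ext u
        simp only [Set.mem_ofPred_eq, Set.mem_iUnion, exists_prop, one_mul]
      rw [this]
      exact isOpen_iUnion fun m => isOpen_iUnion fun _ => isOpen_iUnion fun h =>
        isOpen_iUnion fun _ => isOpen_iUnion fun _ => isOpen_conj_mem (hc.isOpen_P m) _ _
    · obtain ⟨m, hm, h, u, hu, h1, h2, h3⟩ := hc.exists_finitary_near ha c.out v l r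
      exact ⟨u, hu, m, hm, h, h1, h2, h3⟩
  let ext : ∀ m, (Fin (j + 1) → G ⧸ U m) → ℕ → G := fun m θ i =>
    if h : i < j + 1 then (θ ⟨i, h⟩).out else 1
  have hext : ∀ᶠ u in residual G, ∀ (n m : ℕ) (c : G ⧸ U n) (θ : Fin (j + 1) → G ⧸ U m),
      n ≤ m → (∀ i ≤ j, ext m θ i ∈ P n ∧ ext m θ i ∈ P m) →
      (∀ i < j, (ext m θ i)⁻¹ * (c.out⁻¹ * a i * c.out) ∈ U n) →
      (ext m θ j)⁻¹ * (c.out⁻¹ * u * c.out) ∈ U n → ∃ h, c.out⁻¹ * h ∈ U n ∧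
        (∀ i < j, (ext m θ i)⁻¹ * (h⁻¹ * a i * h) ∈ U m) ∧
          (ext m θ j)⁻¹ * (h⁻¹ * u * h) ∈ U m := by
    refine eventually_countable_forall.2 fun n => eventually_countable_forall.2 fun m =>
      eventually_countable_forall.2 fun c => eventually_countable_forall.2 fun θ => ?_
    simp only [eventually_imp_distrib_left]
    intro hnm hθ hθ'
    refine residual_of_dense_open ?_ (hc.dense_of_forall_coset fun v r => ?_)
    · have : {u | (ext m θ j)⁻¹ * (c.out⁻¹ * u * c.out) ∈ U n → ∃ h, c.out⁻¹ * h ∈ U n ∧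
          (∀ i < j, (ext m θ i)⁻¹ * (h⁻¹ * a i * h) ∈ U m) ∧
          (ext m θ j)⁻¹ * (h⁻¹ * u * h) ∈ U m} =
          {u | (ext m θ j)⁻¹ * (c.out⁻¹ * u * c.out) ∈ U n}ᶜ ∪ ⋃ (h : G)
            (_ : c.out⁻¹ * h ∈ U n) (_ : ∀ i < j, (ext m θ i)⁻¹ * (h⁻¹ * a i * h) ∈ U m),
            {u | (ext m θ j)⁻¹ * (h⁻¹ * u * h) ∈ U m} := by
        ext u
        simp only [Set.mem_ofPred_eq, Set.mem_union, Set.mem_compl_iff, Set.mem_iUnion, exists_prop,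
          imp_iff_not_or]
      rw [this]
      refine IsOpen.union ?_ (isOpen_iUnion fun h => isOpen_iUnion fun _ =>
        isOpen_iUnion fun _ => isOpen_conj_mem (hc.isOpen m) _ _)
      exact (((U n).isClosed_of_isOpen (hc.isOpen n)).preimage (by fun_prop :
        Continuous fun u : G => (ext m θ j)⁻¹ * (c.out⁻¹ * u * c.out))).isOpen_compl
    · obtain ⟨u, hu, hu'⟩ := hc.exists_extension_near ha hnm c.out v r _ hθ hθ'
      exact ⟨u, hu, hu'⟩
  filter_upwards [hfin, hext] with u hu1 hu2
  constructor
  · intro g l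
    obtain ⟨m, hm, h, h1, h2, h3⟩ := hu1 l (g : G ⧸ U l)
    have hg : g⁻¹ * (g : G ⧸ U l).out ∈ U l := QuotientGroup.eq.1 (by simp)
    refine ⟨m, hm, h, ?_, fun i hi => ?_⟩
    · have := mul_mem hg h1
      simpa [mul_assoc] using this
    · obtain hi | rfl := Nat.lt_succ_iff_lt_or_eq.1 hi
      · rw [update_of_ne hi.ne]
        exact h2 i hi
      · simpa using h3
  · intro n m hnm g θ hθ
    let θ' : Fin (j + 1) → G ⧸ U m := fun i => (θ i : G ⧸ U m)
    have hout : ∀ {k} (g : G), g⁻¹ * (g : G ⧸ U k).out ∈ U k := fun g =>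
      QuotientGroup.eq.1 (by simp)
    set g' := (g : G ⧸ U n).out with hg'
    have hg : g⁻¹ * g' ∈ U n := hout g
    have hθθ' : ∀ i ≤ j, (θ i)⁻¹ * ext m θ' i ∈ U m := by
      intro i hi
      simp only [ext, θ', Nat.lt_succ_of_le hi, dif_pos]
      exact hout _
    have hP : ∀ i ≤ j, ext m θ' i ∈ P n ∧ ext m θ' i ∈ P m := by
      intro i hi
      have h1 := hθθ' i hi
      have h2 := hθ i (Nat.lt_succ_of_le hi)
      constructor
      · simpa using mul_mem h2.1 (hc.le n (hc.anti hnm h1))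
      · simpa using mul_mem h2.2.1 (hc.le m h1)
    have hconj : ∀ i ≤ j, (ext m θ' i)⁻¹ * (g'⁻¹ * update a j u i * g') ∈ U n := by
      intro i hi
      have h2 := hθ i (Nat.lt_succ_of_le hi)
      have e : (ext m θ' i)⁻¹ * (g'⁻¹ * update a j u i * g') =
        ((θ i)⁻¹ * ext m θ' i)⁻¹ * ((θ i)⁻¹ * (g⁻¹ * g')⁻¹ * θ i) *
          ((θ i)⁻¹ * (g⁻¹ * update a j u i * g)) * (g⁻¹ * g') := by group
      rw [e]
      exact mul_mem (mul_mem (mul_mem (inv_mem (hc.anti hnm (hθθ' i hi)))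
        (hc.normalizes' h2.1 (inv_mem hg))) h2.2.2) hg
    obtain ⟨h, h1, h2, h3⟩ := hu2 n m (g : G ⧸ U n) θ' hnm hP
      (fun i hi => by simpa [hi.ne] using hconj i hi.le) (by simpa using hconj j le_rfl)
    refine ⟨h, ?_, fun i hi => ?_⟩
    · have := mul_mem hg h1
      simpa [mul_assoc, hg'] using this
    · have e : (θ i)⁻¹ * (h⁻¹ * update a j u i * h) =
        ((θ i)⁻¹ * ext m θ' i) * ((ext m θ' i)⁻¹ * (h⁻¹ * update a j u i * h)) := by group
      rw [e]
      refine mul_mem (hθθ' i (Nat.lt_succ_iff.1 hi)) ?_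
      obtain hi | rfl := Nat.lt_succ_iff_lt_or_eq.1 hi
      · rw [update_of_ne hi.ne]
        exact h2 i hi
      · simpa using h3

end AmalgamationChain

end GenericTuples

section BackAndForth

open Topology Filter Function

namespace AmalgamationChain

variable {G : Type*} [Group G] [TopologicalSpace G] {U P : ℕ → Subgroup G}

theorem tendsto_of_eventually_mem [IsTopologicalGroup G] (hc : AmalgamationChain U P) {κ : ℕ → G}
    {k : G} (h : ∀ r, ∀ᶠ j in atTop, k⁻¹ * κ j ∈ U r) : Tendsto κ atTop (𝓝 k) := by
  rw [tendsto_def]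
  intro W hW
  have : (fun u => k * u) ⁻¹' W ∈ 𝓝 (1 : G) :=
    (continuous_const_mul k).continuousAt.preimage_mem_nhds (by simpa using hW)
  obtain ⟨r, hr⟩ := hc.basis _ this
  filter_upwards [h r] with j hj
  simpa using hr hj

theorem exists_tendsto [IsTopologicalGroup G] (hc : AmalgamationChain U P) {κ : ℕ → G}
    (h : ∀ j, (κ j)⁻¹ * κ (j + 1) ∈ U j ∧ κ j * (κ (j + 1))⁻¹ ∈ U j) :
    ∃ k, Tendsto κ atTop (𝓝 k) := by
  obtain ⟨k, hk⟩ := hc.complete κ fun r => by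
    filter_upwards [eventually_ge_atTop r] with j hj
    exact ⟨hc.anti hj (h j).1, hc.anti hj (h j).2⟩
  refine ⟨k, hc.tendsto_of_eventually_mem fun r => ?_⟩
  filter_upwards [hk r] with j hj
  simpa using inv_mem hj

/-- A partial match of the tuples `b` and `b'` after conjugation by `h` and `h'`. -/
structure IsMatch (U P : ℕ → Subgroup G) (j : ℕ) (b b' : ℕ → G) (h h' : G) (m : ℕ) :
    Prop where
  mem : ∀ i < j, h⁻¹ * b i * h ∈ P m
  agree : ∀ i < j, (h⁻¹ * b i * h)⁻¹ * (h'⁻¹ * b' i * h') ∈ U m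

theorem IsMatch.symm (hc : AmalgamationChain U P) {j : ℕ} {b b' : ℕ → G} {h h' : G} {m : ℕ}
    (H : IsMatch U P j b b' h h' m) : IsMatch U P j b' b h' h m where
  mem i hi := by
    have := mul_mem (H.mem i hi) (hc.le m (H.agree i hi))
    rwa [mul_inv_cancel_left] at this
  agree i hi := by simpa using inv_mem (H.agree i hi)

theorem IsMatch.step (hc : AmalgamationChain U P) {j : ℕ} {b b' : ℕ → G}
    (hb : IsGenericTuple U P j b) (hb' : IsGenericTuple U P j b') {h h' : G} {m : ℕ}
    (H : IsMatch U P j b b' h h' m) (l : ℕ) (hl : m ≤ l) :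
    ∃ h₁ h₁' m₁, l ≤ m₁ ∧ h⁻¹ * h₁ ∈ U l ∧ h'⁻¹ * h₁' ∈ U m ∧
      IsMatch U P j b b' h₁ h₁' m₁ := by
  obtain ⟨m₁, hm₁, h₁, hh₁, hP⟩ := hb.finitary h l
  have hh₁' := hc.anti hl hh₁
  obtain ⟨h₁', h1, h2⟩ := hb'.extension m m₁ (hl.trans hm₁) h' (fun i => h₁⁻¹ * b i * h₁)
    fun i hi => by
      refine ⟨?_, hP i hi, ?_⟩
      · have e : h₁⁻¹ * b i * h₁ = (h⁻¹ * h₁)⁻¹ * (h⁻¹ * b i * h) * (h⁻¹ * h₁) := by group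
        rw [e]
        exact mul_mem (mul_mem (inv_mem (hc.le m hh₁')) (H.mem i hi)) (hc.le m hh₁')
      · have e : (h₁⁻¹ * b i * h₁)⁻¹ * (h'⁻¹ * b' i * h') = (h⁻¹ * h₁)⁻¹ *
          ((h⁻¹ * b i * h)⁻¹ * (h⁻¹ * h₁) * (h⁻¹ * b i * h)) *
            ((h⁻¹ * b i * h)⁻¹ * (h'⁻¹ * b' i * h')) := by group
        rw [e]
        exact mul_mem (mul_mem (inv_mem hh₁') (hc.normalizes' (H.mem i hi) hh₁')) (H.agree i hi)
  exact ⟨h₁, h₁', m₁, hm₁, hh₁, h1, hP, h2⟩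

theorem IsMatch.double_step [IsTopologicalGroup G] (hc : AmalgamationChain U P) {j : ℕ}
    {b b' : ℕ → G} (hb : IsGenericTuple U P j b) (hb' : IsGenericTuple U P j b') {h h' : G} {m : ℕ}
    (H : IsMatch U P j b b' h h' m) (r : ℕ) :
    ∃ h₁ h₁' m₁, m ≤ m₁ ∧ h⁻¹ * h₁ ∈ U m ∧ h'⁻¹ * h₁' ∈ U m ∧
      IsMatch U P j b b' h₁ h₁' m₁ ∧ (∀ u ∈ U m₁, h₁ * u * h₁⁻¹ ∈ U r) ∧
        (∀ u ∈ U m₁, h₁' * u * h₁'⁻¹ ∈ U r) := by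
  obtain ⟨l, -, hl⟩ := hc.exists_conj_le h r
  obtain ⟨h₁, h₁', m₁, hm₁, hh₁, hh₁', H₁⟩ := H.step hc hb hb' (max l m) (le_max_right _ _)
  obtain ⟨l₁, -, hl₁⟩ := hc.exists_conj_le h₁' r
  obtain ⟨h₂', h₂, m₂, hm₂, hh₂', hh₂, H₂⟩ :=
    (H₁.symm hc).step hc hb' hb (max l₁ m₁) (le_max_right _ _)
  refine ⟨h₂, h₂', m₂, by omega, ?_, ?_, H₂.symm hc, fun u hu => ?_, fun u hu => ?_⟩
  · have := mul_mem (hc.anti (le_max_right l m) hh₁) (hc.anti (by omega) hh₂)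
    simpa [mul_assoc] using this
  · have := mul_mem hh₁' (hc.anti (a := m) (by omega) hh₂')
    simpa [mul_assoc] using this
  · have e : h₂ * u * h₂⁻¹ = h * ((h⁻¹ * h₁) * ((h₁⁻¹ * h₂) * u * (h₁⁻¹ * h₂)⁻¹) *
      (h⁻¹ * h₁)⁻¹) * h⁻¹ := by group
    rw [e]
    refine hl _ (le_max_left l m) _ (mul_mem (mul_mem hh₁ ?_) (inv_mem hh₁))
    exact hc.anti hm₁ (mul_mem (mul_mem hh₂ (hc.anti (by omega) hu)) (inv_mem hh₂))
  · have e : h₂' * u * h₂'⁻¹ = h₁' * ((h₁'⁻¹ * h₂') * u * (h₁'⁻¹ * h₂')⁻¹) * h₁'⁻¹ := by group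
    rw [e]
    exact hl₁ _ (le_max_left l₁ m₁) _
      (mul_mem (mul_mem hh₂' (hc.anti (by omega) hu)) (inv_mem hh₂'))

theorem exists_conj_of_agree [IsTopologicalGroup G] [T2Space G] (hc : AmalgamationChain U P)
    {j : ℕ} {b b' : ℕ → G} (hb : IsGenericTuple U P j b) (hb' : IsGenericTuple U P j b')
    {h : G} {m : ℕ} (H : IsMatch U P j b b' h h m) :
    ∃ κ, h⁻¹ * κ * h ∈ U m ∧ ∀ i < j, κ * b i * κ⁻¹ = b' i := by
  let S := {s : G × G × ℕ // IsMatch U P j b b' s.1 s.2.1 s.2.2}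
  have hstep : ∀ (r : ℕ) (s : S), ∃ s' : S, s.1.2.2 ≤ s'.1.2.2 ∧ s.1.1⁻¹ * s'.1.1 ∈ U s.1.2.2 ∧
      s.1.2.1⁻¹ * s'.1.2.1 ∈ U s.1.2.2 ∧ (∀ u ∈ U s'.1.2.2, s'.1.1 * u * s'.1.1⁻¹ ∈ U r) ∧
        (∀ u ∈ U s'.1.2.2, s'.1.2.1 * u * s'.1.2.1⁻¹ ∈ U r) := by
    rintro r ⟨⟨h, h', m⟩, H⟩
    obtain ⟨h₁, h₁', m₁, h1, h2, h3, H₁, h4, h5⟩ := IsMatch.double_step hc hb hb' H r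
    exact ⟨⟨⟨h₁, h₁', m₁⟩, H₁⟩, h1, h2, h3, h4, h5⟩
  choose f hf using hstep
  let s : ℕ → S := fun n => Nat.rec ⟨(h, h, m), H⟩ f n
  have hs : ∀ n, s (n + 1) = f n (s n) := fun n => rfl
  let κ : ℕ → G := fun n => (s n).1.2.1 * (s n).1.1⁻¹
  have hinv : ∀ n, m ≤ (s n).1.2.2 ∧ h⁻¹ * (s n).1.1 ∈ U m ∧ h⁻¹ * (s n).1.2.1 ∈ U m := by
    intro n
    induction n with
    | zero => simp [s]
    | succ n ih =>
      obtain ⟨h1, h2, h3, -, -⟩ := hf n (s n)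
      rw [hs]
      refine ⟨ih.1.trans h1, ?_, ?_⟩
      · simpa [mul_assoc] using mul_mem ih.2.1 (hc.anti ih.1 h2)
      · simpa [mul_assoc] using mul_mem ih.2.2 (hc.anti ih.1 h3)
  have hκ : ∀ n, (κ (n + 1))⁻¹ * κ (n + 1 + 1) ∈ U n ∧ κ (n + 1) * (κ (n + 1 + 1))⁻¹ ∈ U n := by
    intro n
    obtain ⟨h1, h2, h3, -, -⟩ := hf (n + 1) (s (n + 1))
    obtain ⟨-, -, -, h4, h5⟩ := hf n (s n)
    rw [← hs] at h1 h2 h3 h4 h5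
    have e1 : (κ (n + 1))⁻¹ * κ (n + 1 + 1) = (s (n + 1)).1.1 *
      (((s (n + 1)).1.2.1⁻¹ * (s (n + 1 + 1)).1.2.1) *
        ((s (n + 1)).1.1⁻¹ * (s (n + 1 + 1)).1.1)⁻¹) * (s (n + 1)).1.1⁻¹ := by
      simp only [κ]; group
    have e2 : κ (n + 1) * (κ (n + 1 + 1))⁻¹ = (s (n + 1)).1.2.1 *
      (((s (n + 1)).1.1⁻¹ * (s (n + 1 + 1)).1.1) *
        ((s (n + 1)).1.2.1⁻¹ * (s (n + 1 + 1)).1.2.1)⁻¹) * (s (n + 1)).1.2.1⁻¹ := by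
      simp only [κ]; group
    rw [e1, e2]
    exact ⟨h4 _ (mul_mem h3 (inv_mem h2)), h5 _ (mul_mem h2 (inv_mem h3))⟩
  obtain ⟨k, hk⟩ := hc.exists_tendsto (κ := fun n => κ (n + 1)) hκ
  refine ⟨k, ?_, fun i hi => ?_⟩
  · have hlim : Tendsto (fun n => h⁻¹ * κ (n + 1) * h) atTop (𝓝 (h⁻¹ * k * h)) :=
      (tendsto_const_nhds.mul hk).mul tendsto_const_nhds
    refine ((U m).isClosed_of_isOpen (hc.isOpen m)).mem_of_tendsto hlim (Eventually.of_forall ?_)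
    intro n
    have := mul_mem (hinv (n + 1)).2.2 (inv_mem (hinv (n + 1)).2.1)
    have e : h⁻¹ * κ (n + 1) * h =
      h⁻¹ * (s (n + 1)).1.2.1 * (h⁻¹ * (s (n + 1)).1.1)⁻¹ := by simp only [κ]; group
    rw [e]
    exact this
  · have hlim : Tendsto (fun n => κ (n + 1) * b i * (κ (n + 1))⁻¹) atTop (𝓝 (k * b i * k⁻¹)) :=
      (hk.mul tendsto_const_nhds).mul hk.inv
    refine tendsto_nhds_unique hlim (hc.tendsto_of_eventually_mem fun r => ?_)
    filter_upwards [eventually_ge_atTop r] with n hn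
    obtain ⟨-, -, -, -, h5⟩ := hf n (s n)
    rw [← hs] at h5
    have h6 := (s (n + 1)).2.agree i hi
    have e : (b' i)⁻¹ * (κ (n + 1) * b i * (κ (n + 1))⁻¹) = (s (n + 1)).1.2.1 *
      (((s (n + 1)).1.1⁻¹ * b i * (s (n + 1)).1.1)⁻¹ *
        ((s (n + 1)).1.2.1⁻¹ * b' i * (s (n + 1)).1.2.1))⁻¹ * (s (n + 1)).1.2.1⁻¹ := by
      simp only [κ]; group
    rw [e]
    exact hc.anti hn (h5 _ (inv_mem h6))

end AmalgamationChain

end BackAndForth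

section Residual

open Topology Filter Function TopologicalSpace

theorem dense_setOf_forall_ne_inv_mul_mem {G ι : Type*} [Group G] [MetricSpace G]
    [IsTopologicalGroup G] [CompleteSpace G] [Finite ι] {D : Set G} (hD : IsOpen D)
    (hD' : Dense D) : Dense {u : ι → G | ∀ i k, i ≠ k → (u i)⁻¹ * u k ∈ D} := by
  classical
  have := Fintype.ofFinite ι
  have : {u : ι → G | ∀ i k, i ≠ k → (u i)⁻¹ * u k ∈ D} =
      ⋂ p : {p : ι × ι // p.1 ≠ p.2}, (fun u : ι → G => (u p.1.1)⁻¹ * u p.1.2) ⁻¹' D := by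
    ext u
    simp
  rw [this]
  refine dense_iInter_of_isOpen ?_ ?_
  · rintro ⟨⟨i, k⟩, hik⟩
    exact hD.preimage (by fun_prop)
  · rintro ⟨⟨i, k⟩, hik⟩ u
    rw [mem_closure_iff_nhds]
    intro W hW
    have hcont : Continuous fun x : G => update u k (u i * x) := by fun_prop
    have hu : update u k (u i * ((u i)⁻¹ * u k)) = u := by simp
    obtain ⟨x, hx, hxD⟩ := hD'.inter_nhds_nonempty
      (hcont.continuousAt.preimage_mem_nhds (x := (u i)⁻¹ * u k) (by rwa [hu]))
    refine ⟨_, hxD, ?_⟩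
    have hik' : i ≠ k := hik
    simpa [hik'] using hx

theorem exists_depth_dist_lt {M : Type*} [PseudoMetricSpace M] {f : (ℕ → Bool) → M}
    (hf : Continuous f) {ε : ℝ} (hε : 0 < ε) :
    ∃ n, ∀ y z : ℕ → Bool, (∀ i < n, y i = z i) → dist (f y) (f z) < ε := by
  let O : ℕ → Set (ℕ → Bool) := fun n =>
    {x | ∀ y ∈ PiNat.cylinder x n, ∀ z ∈ PiNat.cylinder x n, dist (f y) (f z) < ε}
  have hO : ∀ n, IsOpen (O n) := by
    intro n
    refine isOpen_iff_forall_mem_open.2 fun x hx => ⟨PiNat.cylinder x n, fun y hy => ?_,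
      PiNat.isOpen_cylinder _ x n, PiNat.self_mem_cylinder x n⟩
    have := PiNat.mem_cylinder_iff_eq.1 hy
    intro z hz w hw
    rw [this] at hz hw
    exact hx z hz w hw
  have hmono : Monotone O := fun n m hnm x hx y hy z hz =>
    hx y (PiNat.cylinder_anti x hnm hy) z (PiNat.cylinder_anti x hnm hz)
  have hcov : (Set.univ : Set (ℕ → Bool)) ⊆ ⋃ n, O n := by
    intro x _
    have hball : f ⁻¹' Metric.ball (f x) (ε / 2) ∈ 𝓝 x :=
      hf.continuousAt.preimage_mem_nhds (Metric.ball_mem_nhds _ (half_pos hε))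
    obtain ⟨_, ⟨y, n, rfl⟩, hx, hsub⟩ :=
      (PiNat.isTopologicalBasis_cylinders _).mem_nhds_iff.1 hball
    rw [← PiNat.mem_cylinder_iff_eq.1 hx] at hsub
    refine Set.mem_iUnion.2 ⟨n, fun z hz w hw => ?_⟩
    have h1 : dist (f z) (f x) < ε / 2 := hsub hz
    have h2 : dist (f w) (f x) < ε / 2 := hsub hw
    have := dist_triangle_right (f z) (f w) (f x)
    linarith
  obtain ⟨n, hn⟩ := isCompact_univ.elim_directed_cover O hO hcov hmono.directed_le
  refine ⟨n, fun y z hyz => hn (Set.mem_univ z) y ?_ z (PiNat.self_mem_cylinder z n)⟩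
  exact PiNat.mem_cylinder_iff.2 hyz

theorem exists_cantor_family {G : Type*} [Group G] [MetricSpace G] [IsTopologicalGroup G]
    [CompleteSpace G] {X : Set G} (hX : X ∈ residual G) {V : Set G} (hV : IsOpen V)
    (hV1 : (1 : G) ∈ V) :
    ∃ u : (ℕ → Bool) → G, (∀ z, u z ∈ V) ∧ ∀ z z', z ≠ z' → (u z)⁻¹ * u z' ∈ X := by
  obtain ⟨Y, hYX, hY, hYd⟩ := mem_residual.1 hX
  obtain ⟨D, hD, rfl⟩ := hY.eq_iInter_nat
  have hDd : ∀ n, Dense (D n) := fun n => hYd.mono (Set.iInter_subset _ n)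
  let K : ℕ → Set ((ℕ → Bool) × (ℕ → Bool)) := fun n => {p | p.1 n ≠ p.2 n}
  let E : ℕ × ℕ → Set C(ℕ → Bool, G) := fun q =>
    {u | ∀ p ∈ K q.1, (u p.1)⁻¹ * u p.2 ∈ D q.2}
  have hE : ∀ q, IsOpen (E q) := by
    rintro ⟨n, k⟩
    have hK : IsCompact (K n) := by
      refine IsClosed.isCompact ?_
      have : K n = (fun p : (ℕ → Bool) × (ℕ → Bool) => (p.1 n, p.2 n)) ⁻¹' {b | b.1 ≠ b.2} := rfl
      rw [this]
      exact (isClosed_discrete _).preimage (by fun_prop)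
    let Φ : C(ℕ → Bool, G) → C((ℕ → Bool) × (ℕ → Bool), G) := fun u =>
      (u.comp ⟨Prod.fst, continuous_fst⟩)⁻¹ * u.comp ⟨Prod.snd, continuous_snd⟩
    have hΦ : Continuous Φ :=
      ((ContinuousMap.continuous_postcomp ⟨Inv.inv, continuous_inv⟩).comp
        (ContinuousMap.continuous_precomp _)).mul (ContinuousMap.continuous_precomp _)
    exact (ContinuousMap.isOpen_setOfPred_mapsTo hK (hD k)).preimage hΦ
  have hEd : ∀ q, Dense (E q) := by
    rintro ⟨n, k⟩ f
    rw [Metric.mem_closure_iff]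
    intro ε hε
    obtain ⟨m, hm⟩ := exists_depth_dist_lt f.continuous (half_pos hε)
    let N := max m (n + 1)
    let ext : (Fin N → Bool) → ℕ → Bool := fun w i => if h : i < N then w ⟨i, h⟩ else false
    let res : (ℕ → Bool) → Fin N → Bool := fun z i => z i
    obtain ⟨v, hvD, hv⟩ := Metric.dense_iff.1 (dense_setOf_forall_ne_inv_mul_mem
      (ι := Fin N → Bool) (hD k) (hDd k)) (fun w => f (ext w)) (ε / 2) (half_pos hε)
    have hres : Continuous res := by fun_prop
    refine ⟨⟨fun z => v (res z), (continuous_of_discreteTopology (f := v)).comp hres⟩, ?_, ?_⟩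
    · rintro ⟨z, z'⟩ hz
      refine hv _ _ fun h => hz ?_
      exact congrFun h ⟨n, by omega⟩
    · rw [ContinuousMap.dist_lt_iff hε]
      intro z
      have h1 : dist (f z) (f (ext (res z))) < ε / 2 := hm _ _ fun i hi => by
        have : i < N := by omega
        simp [ext, res, this]
      have h2 : dist (v (res z)) (f (ext (res z))) < ε / 2 :=
        (dist_le_pi_dist v (fun w => f (ext w)) (res z)).trans_lt hvD
      have := dist_triangle_right (f z) (v (res z)) (f (ext (res z)))
      simp only [ContinuousMap.coe_mk]
      linarith
  have hW : IsOpen {u : C(ℕ → Bool, G) | Set.MapsTo u Set.univ V} :=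
    ContinuousMap.isOpen_setOfPred_mapsTo isCompact_univ hV
  obtain ⟨u, huV, huE⟩ := (dense_iInter_of_isOpen hE hEd).inter_open_nonempty _ hW
    ⟨ContinuousMap.const _ 1, fun _ _ => hV1⟩
  refine ⟨u, fun z => huV (Set.mem_univ z), fun z z' hz => hYX (Set.mem_iInter.2 fun k => ?_)⟩
  obtain ⟨n, hn⟩ := Function.ne_iff.1 hz
  exact Set.mem_iInter.1 huE (n, k) (z, z') hn

theorem exists_mem_residual_inter_subgroup {G : Type*} [Group G] [MetricSpace G]
    [IsTopologicalGroup G] [CompleteSpace G] {X : Set G} (hX : X ∈ residual G) {V : Subgroup G}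
    (hV : IsOpen (V : Set G)) {H : Subgroup G} (hH : Cardinal.mk (G ⧸ H) < Cardinal.continuum) :
    ∃ u ∈ X, u ∈ V ∧ u ∈ H := by
  obtain ⟨u, huV, huX⟩ := exists_cantor_family hX hV (one_mem V)
  have : ¬ Injective fun z => (u z : G ⧸ H) := by
    intro hinj
    have := Cardinal.lift_mk_le_lift_mk_of_injective hinj
    simp at this
    exact absurd hH (not_lt.2 (by simpa using this))
  simp only [Injective, not_forall] at this
  obtain ⟨z, z', h, hne⟩ := this
  exact ⟨_, huX z z' hne, mul_mem (inv_mem (huV z)) (huV z'), QuotientGroup.eq.1 h⟩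

theorem exists_mem_residual_inter_not_mem {G : Type*} [Group G] [MetricSpace G]
    [IsTopologicalGroup G] [CompleteSpace G] {X : Set G} (hX : X ∈ residual G) {V : Subgroup G}
    (hV : IsOpen (V : Set G)) {H : Subgroup G} (hH : ¬ V ≤ H) :
    ∃ u ∈ X, u ∈ V ∧ u ∉ H := by
  obtain ⟨g, hgV, hgH⟩ := SetLike.not_le_iff_exists.1 hH
  let e : G ≃ₜ G := (Homeomorph.inv G).trans (Homeomorph.mulRight g)
  have hX' : e ⁻¹' X ∈ residual G :=
    tendsto_residual_of_isOpenMap e.continuous e.isOpenMap hX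
  obtain ⟨u, huV, hu1, hu2⟩ :=
    (dense_of_mem_residual (inter_mem hX hX')).inter_open_nonempty V hV ⟨1, one_mem V⟩
  by_cases hu : u ∈ H
  · refine ⟨u⁻¹ * g, hu2, mul_mem (inv_mem huV) hgV, fun h => hgH ?_⟩
    simpa using mul_mem hu h
  · exact ⟨u, hu1, huV, hu⟩

end Residual

section SmallIndex

open Topology Filter Function TopologicalSpace

namespace AmalgamationChain

variable {G : Type*} [Group G] {U P : ℕ → Subgroup G}

theorem exists_branching [MetricSpace G] [IsTopologicalGroup G] [CompleteSpace G]
    (hc : AmalgamationChain U P) {H : Subgroup G}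
    (hH : Cardinal.mk (G ⧸ H) < Cardinal.continuum) (hU : ∀ n, ¬ U n ≤ H) {j : ℕ} {a : ℕ → G}
    (ha : IsGenericTuple U P j a) (k : G) :
    ∃ u₀ u₁ κ, IsGenericTuple U P (j + 1) (update a j u₀) ∧
      IsGenericTuple U P (j + 1) (update a j u₁) ∧ u₀ ∈ H ∧ u₁ ∉ H ∧
      (∀ i < j, κ * a i * κ⁻¹ = a i) ∧ κ * u₀ * κ⁻¹ = u₁ ∧ κ ∈ U j ∧ k⁻¹ * κ * k ∈ U j := by
  obtain ⟨l, hjl, hl⟩ := hc.exists_conj_le k⁻¹ j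
  obtain ⟨m, hm, h, hh, hP⟩ := ha.finitary 1 l
  replace hh : h ∈ U l := by simpa using hh
  let V : Subgroup G := (U m).comap (MulAut.conj h⁻¹).toMonoidHom
  have hVmem : ∀ u, u ∈ V ↔ h⁻¹ * u * h ∈ U m := fun u => by
    simp [V, Subgroup.mem_comap]
  have hVl : ∀ u ∈ V, u ∈ U l := fun u hu => by
    have := mul_mem (mul_mem hh (hc.anti hm ((hVmem u).1 hu))) (inv_mem hh)
    simpa [mul_assoc] using this
  have hVo : IsOpen (V : Set G) := by
    have : (V : Set G) = {u | 1 * (h⁻¹ * u * h) ∈ U m} := by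
      ext u
      simp [hVmem]
    rw [this]
    exact isOpen_conj_mem (hc.isOpen m) _ _
  have hVH : ¬ V ≤ H := fun hle => by
    obtain ⟨n, hn⟩ := hc.basis _ (hVo.mem_nhds (one_mem V))
    exact hU n fun u hu => hle (hn hu)
  have hres := hc.eventually_isGenericTuple_update ha
  obtain ⟨u₀, h₀, h₀V, h₀H⟩ := exists_mem_residual_inter_subgroup hres hVo hH
  obtain ⟨u₁, h₁, h₁V, h₁H⟩ := exists_mem_residual_inter_not_mem hres hVo hVH
  rw [hVmem] at h₀V h₁V
  have hmatch : IsMatch U P (j + 1) (update a j u₀) (update a j u₁) h h m := by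
    constructor
    · intro i hi
      obtain hi | rfl := Nat.lt_succ_iff_lt_or_eq.1 hi
      · simpa [hi.ne] using hP i hi
      · simpa using hc.le m h₀V
    · intro i hi
      obtain hi | rfl := Nat.lt_succ_iff_lt_or_eq.1 hi
      · simp [hi.ne, mul_assoc]
      · simpa [mul_assoc] using mul_mem (inv_mem h₀V) h₁V
  obtain ⟨κ, hκ, hκ'⟩ := hc.exists_conj_of_agree h₀ h₁ hmatch
  have hκl := hVl κ ((hVmem κ).2 hκ)
  refine ⟨u₀, u₁, κ, h₀, h₁, h₀H, h₁H, fun i hi => ?_, ?_, hc.anti hjl hκl, ?_⟩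
  · simpa [hi.ne] using hκ' i (hi.trans j.lt_succ_self)
  · simpa using hκ' j j.lt_succ_self
  · simpa using hl l le_rfl κ hκl

theorem exists_le_of_index_lt_continuum_aux [MetricSpace G] [IsTopologicalGroup G] [CompleteSpace G]
    (hc : AmalgamationChain U P) {H : Subgroup G}
    (hH : Cardinal.mk (G ⧸ H) < Cardinal.continuum) : ∃ n, U n ≤ H := by
  by_contra! hU
  let Node : ℕ → Type _ := fun j => {p : (ℕ → G) × G // IsGenericTuple U P j p.1}
  have hstep : ∀ j (ν : Node j), ∃ u₀ u₁ κ, IsGenericTuple U P (j + 1) (update ν.1.1 j u₀) ∧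
      IsGenericTuple U P (j + 1) (update ν.1.1 j u₁) ∧ u₀ ∈ H ∧ u₁ ∉ H ∧
      (∀ i < j, κ * ν.1.1 i * κ⁻¹ = ν.1.1 i) ∧ κ * u₀ * κ⁻¹ = u₁ ∧ κ ∈ U j ∧
        ν.1.2⁻¹ * κ * ν.1.2 ∈ U j :=
    fun j ν => hc.exists_branching hH hU ν.2 ν.1.2
  choose u₀ u₁ κ hg₀ hg₁ hH₀ hH₁ hcomm hconj hκ hκ' using hstep
  let child : ∀ j, Node j → Bool → Node (j + 1) := fun j ν b =>
    bif b then ⟨(update ν.1.1 j (u₁ j ν), κ j ν * ν.1.2), hg₁ j ν⟩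
    else ⟨(update ν.1.1 j (u₀ j ν), ν.1.2), hg₀ j ν⟩
  let path : (ℕ → Bool) → ∀ j, Node j := fun z j =>
    Nat.rec (motive := Node) ⟨(1, 1), IsGenericTuple.zero _⟩ (fun j ν => child j ν (z j)) j
  have hpath : ∀ z j, path z (j + 1) = child j (path z j) (z j) := fun z j => rfl
  have hpath_congr : ∀ z z' j, (∀ i < j, z i = z' i) → path z j = path z' j := by
    intro z z' j
    induction j with
    | zero => intro _; rfl
    | succ j ih =>
      intro h
      rw [hpath, hpath, ih fun i hi => h i (hi.trans j.lt_succ_self), h j j.lt_succ_self]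
  have hlim : ∀ z, ∃ k, Tendsto (fun j => (path z j).1.2) atTop (𝓝 k) := by
    refine fun z => hc.exists_tendsto fun j => ?_
    rw [hpath]
    cases z j
    · simp [child, one_mem]
    · simpa [child, ← mul_assoc] using ⟨hκ' j (path z j), hκ j (path z j)⟩
  choose k hk using hlim
  have hconst : ∀ z j n, ((path z (j + 1 + n)).1.2)⁻¹ * (path z (j + 1 + n)).1.1 j *
      (path z (j + 1 + n)).1.2 = ((path z j).1.2)⁻¹ * u₀ j (path z j) * (path z j).1.2 := by
    intro z j n
    induction n with
    | zero =>
      rw [add_zero, hpath]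
      cases z j
      · simp [child]
      · simp only [child, cond_true, update_self, ← hconj]
        group
    | succ n ih =>
      rw [← ih, ← add_assoc, hpath]
      have hj : j ≠ j + 1 + n := by omega
      cases z (j + 1 + n)
      · simp [child, hj]
      · simp only [child, cond_true, update_of_ne hj]
        nth_rewrite 1 [← hcomm (j + 1 + n) (path z (j + 1 + n)) j (by omega)]
        group
  have hvalue : ∀ z j, (k z)⁻¹ * (path z (j + 1)).1.1 j * k z =
      ((path z j).1.2)⁻¹ * u₀ j (path z j) * (path z j).1.2 := by
    intro z j
    have hstab : ∀ n, (path z (j + 1 + n)).1.1 j = (path z (j + 1)).1.1 j := by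
      intro n
      induction n with
      | zero => rfl
      | succ n ih =>
        have hj : j ≠ j + 1 + n := by omega
        rw [← ih, ← add_assoc, hpath]
        cases z (j + 1 + n) <;> simp [child, hj]
    have h1 : Tendsto (fun i => ((path z i).1.2)⁻¹ * (path z (j + 1)).1.1 j * (path z i).1.2) atTop
        (𝓝 ((k z)⁻¹ * (path z (j + 1)).1.1 j * k z)) :=
      ((hk z).inv.mul tendsto_const_nhds).mul (hk z)
    refine tendsto_nhds_unique h1 (tendsto_const_nhds.congr' ?_)
    filter_upwards [eventually_ge_atTop (j + 1)] with i hi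
    obtain ⟨n, rfl⟩ := Nat.exists_eq_add_of_le hi
    rw [← hconst z j n, hstab]
  have hsplit : ∀ z z' j, (∀ i < j, z i = z' i) → z j = false → z' j = true →
      k z' * (k z)⁻¹ ∉ H := by
    intro z z' j hlt hz hz' hmem
    have h0 := hvalue z j
    have h1 := hvalue z' j
    rw [← hpath_congr z z' j hlt, ← h0, hpath, hpath, hz, hz', ← hpath_congr z z' j hlt] at h1
    simp only [child, cond_true, cond_false, update_self] at h1
    apply hH₁ j (path z j)
    have e : u₁ j (path z j) = (k z' * (k z)⁻¹) * u₀ j (path z j) * (k z' * (k z)⁻¹)⁻¹ := by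
      calc u₁ j (path z j) = k z' * ((k z')⁻¹ * u₁ j (path z j) * k z') * (k z')⁻¹ := by group
        _ = _ := by rw [h1]; group
    rw [e]
    exact mul_mem (mul_mem hmem (hH₀ j _)) (inv_mem hmem)
  have hinj : Injective fun z => (((k z)⁻¹ : G) : G ⧸ H) := by
    intro z z' h
    by_contra hne
    have hmem : k z * (k z')⁻¹ ∈ H := by simpa using QuotientGroup.eq.1 h
    have hlt : ∀ i < PiNat.firstDiff z z', z i = z' i := fun i hi =>
      PiNat.apply_eq_of_lt_firstDiff hi
    have hd := PiNat.apply_firstDiff_ne hne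
    cases h1 : z (PiNat.firstDiff z z') <;> cases h2 : z' (PiNat.firstDiff z z')
    · exact hd (h1.trans h2.symm)
    · exact hsplit z z' _ hlt h1 h2 (by simpa using inv_mem hmem)
    · exact hsplit z' z _ (fun i hi => (hlt i hi).symm) h2 h1 hmem
    · exact hd (h1.trans h2.symm)
  have := Cardinal.lift_mk_le_lift_mk_of_injective hinj
  simp at this
  exact absurd hH (not_lt.2 (by simpa using this))

/-- A subgroup of index less than the continuum contains a member of the chain. -/
theorem exists_le_of_index_lt_continuum [TopologicalSpace G] [IsTopologicalGroup G]
    [IsCompletelyMetrizableSpace G] (hc : AmalgamationChain U P) {H : Subgroup G}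
    (hH : Cardinal.mk (G ⧸ H) < Cardinal.continuum) : ∃ n, U n ≤ H := by
  let := upgradeIsCompletelyMetrizable G
  exact exists_le_of_index_lt_continuum_aux hc hH

end AmalgamationChain

end SmallIndex

section SchreierBasis

open Function

universe u

namespace FreeGroup

section Schreier

variable {X : Type u} (B : Subgroup (FreeGroup X))

theorem norm_lt_of_toWord_cons {g : FreeGroup X} [DecidableEq X] {a : X × Bool}
    {L : List (X × Bool)} (h : g.toWord = a :: L) : (mk L).norm < g.norm := by
  have h1 : (mk L).norm ≤ L.length := norm_mk_le
  have h2 : g.norm = L.length + 1 := by simp [norm, h]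
  omega

/-- A Schreier transversal: each representative is obtained from a representative of smaller
rank by adjoining a letter on the left. -/
theorem exists_schreier_transversal :
    ∃ (τ : FreeGroup X ⧸ B → FreeGroup X) (d : FreeGroup X ⧸ B → ℕ),
      (∀ ω, (τ ω : FreeGroup X ⧸ B) = ω) ∧ τ ((1 : FreeGroup X) : FreeGroup X ⧸ B) = 1 ∧
      ∀ ω, ω ≠ ((1 : FreeGroup X) : FreeGroup X ⧸ B) →
        ∃ (x : X) (ω' : FreeGroup X ⧸ B), d ω' < d ω ∧
          (τ ω = of x * τ ω' ∨ τ ω = (of x)⁻¹ * τ ω') := by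
  classical
  let d : FreeGroup X ⧸ B → ℕ := fun ω => sInf (norm '' {g : FreeGroup X | (g : _ ⧸ B) = ω})
  have hd : ∀ g : FreeGroup X, d g ≤ g.norm := fun g => Nat.sInf_le ⟨g, rfl, rfl⟩
  have hd' : ∀ ω, ∃ g : FreeGroup X, (g : _ ⧸ B) = ω ∧ g.norm = d ω := by
    intro ω
    obtain ⟨g, hg⟩ := QuotientGroup.mk_surjective ω
    exact Nat.sInf_mem (s := norm '' {g : FreeGroup X | (g : _ ⧸ B) = ω}) ⟨_, g, hg, rfl⟩
  have hparent : ∀ ω, ω ≠ ((1 : FreeGroup X) : FreeGroup X ⧸ B) →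
      ∃ (a : X × Bool) (ω' : FreeGroup X ⧸ B), d ω' < d ω ∧ ω = mk [a] • ω' := by
    intro ω hω
    obtain ⟨g, rfl, hg⟩ := hd' ω
    cases hw : g.toWord with
    | nil => exact absurd (by rw [toWord_eq_nil_iff.1 hw]) hω
    | cons a L =>
      refine ⟨a, ((mk L : FreeGroup X) : _ ⧸ B), ?_, ?_⟩
      · rw [← hg]
        exact (hd _).trans_lt (norm_lt_of_toWord_cons hw)
      · rw [MulAction.Quotient.smul_mk, smul_eq_mul, mul_mk, List.singleton_append, ← hw, mk_toWord]
  choose a p hp hpa using hparent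
  let F : ∀ ω, (∀ ω', d ω' < d ω → FreeGroup X) → FreeGroup X := fun ω rec =>
    if h : ω = ((1 : FreeGroup X) : FreeGroup X ⧸ B) then 1 else mk [a ω h] * rec (p ω h) (hp ω h)
  let τ : FreeGroup X ⧸ B → FreeGroup X := (measure d).wf.fix F
  have hτ : ∀ ω, τ ω = if h : ω = ((1 : FreeGroup X) : FreeGroup X ⧸ B) then 1
      else mk [a ω h] * τ (p ω h) := by
    intro ω
    simp only [τ]
    rw [WellFounded.fix_eq]
  refine ⟨τ, d, ?_, by rw [hτ, dif_pos rfl], fun ω hω => ?_⟩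
  · intro ω
    induction h : d ω using Nat.strong_induction_on generalizing ω with
    | _ n ih =>
      rw [hτ]
      split_ifs with hω
      · exact hω.symm
      · rw [← smul_eq_mul, ← MulAction.Quotient.smul_mk, ih _ (h ▸ hp ω hω) (p ω hω) rfl,
          ← hpa ω hω]
  · refine ⟨(a ω hω).1, p ω hω, hp ω hω, ?_⟩
    rw [hτ, dif_neg hω]
    rcases h : a ω hω with ⟨x, b⟩
    cases b
    · right; simp [of, inv_mk, invRev]
    · left; rfl

/-- A subgroup of a free group has a basis containing any prescribed set of letters belonging to
the subgroup. -/
theorem exists_subgroup_basis : ∃ (ι : Type u) (γ : ι → B),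
    Bijective (lift γ) ∧ ∀ x : X, of x ∈ B → ∃ i, (γ i : FreeGroup X) = of x := by
  classical
  obtain ⟨τ, d, hτ, hτ1, hτd⟩ := exists_schreier_transversal B
  let Ω := FreeGroup X ⧸ B
  let o : Ω := ((1 : FreeGroup X) : FreeGroup X ⧸ B)
  let S := {e : X × Ω // τ (of e.1 • e.2) ≠ of e.1 * τ e.2}
  have hτo : ∀ ω : Ω, τ ω • o = ω := fun ω => by
    simp only [o]
    rw [MulAction.Quotient.smul_mk, smul_eq_mul, mul_one, hτ]
  have hmemB : ∀ g : FreeGroup X, g ∈ B ↔ g • o = o := fun g => by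
    simp only [o]
    rw [MulAction.Quotient.smul_mk, smul_eq_mul, mul_one, eq_comm, QuotientGroup.eq]
    simp
  have hcoset : ∀ (g : FreeGroup X) (ω : Ω), (τ (g • ω))⁻¹ * g * τ ω ∈ B := fun g ω => by
    rw [hmemB, mul_smul, mul_smul, hτo, inv_smul_eq_iff, hτo]
  let γ : S → B := fun e => ⟨_, hcoset (of e.1.1) e.1.2⟩
  let f : X → Ω → FreeGroup S := fun x ω =>
    if h : τ (of x • ω) ≠ of x * τ ω then of ⟨(x, ω), h⟩ else 1
  let act : X → Equiv.Perm (Ω × FreeGroup S) := fun x =>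
    { toFun := fun p => (of x • p.1, f x p.1 * p.2)
      invFun := fun p => ((of x)⁻¹ • p.1, (f x ((of x)⁻¹ • p.1))⁻¹ * p.2)
      left_inv := fun p => by simp
      right_inv := fun p => by simp }
  let Φ : FreeGroup X →* Equiv.Perm (Ω × FreeGroup S) := lift act
  have hΦx : ∀ x ω y, Φ (of x) (ω, y) = (of x • ω, f x ω * y) := fun x ω y => by
    simp [Φ, act]
  have hΦτ : ∀ ω y, Φ (τ ω) (o, y) = (ω, y) := by
    intro ω y
    induction h : d ω using Nat.strong_induction_on generalizing ω with
    | _ n ih =>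
      by_cases hω : ω = o
      · rw [hω, hτ1]
        simp
      obtain ⟨x, ω', hlt, hx | hx⟩ := hτd ω hω
      · have hω' : of x • ω' = ω := by
          rw [← hτo ω, hx, mul_smul, hτo]
        rw [hx, _root_.map_mul, Equiv.Perm.mul_apply, ih _ (h ▸ hlt) ω' rfl, hΦx, hω']
        simp [f, hω', hx]
      · have hω' : of x • ω = ω' := by
          rw [← hτo ω, hx, mul_smul, smul_inv_smul, hτo]
        rw [hx, _root_.map_mul, Equiv.Perm.mul_apply, ih _ (h ▸ hlt) ω' rfl, _root_.map_inv,
          Equiv.Perm.inv_eq_iff_eq, hΦx, hω']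
        simp [f, hω', hx]
  have hΦγ : ∀ (w : FreeGroup S) y, Φ (lift γ w : B) (o, y) = (o, w * y) := by
    intro w
    induction w using FreeGroup.induction_on with
    | C1 => simp
    | of e =>
      intro y
      obtain ⟨⟨x, ω⟩, he⟩ := e
      have he' : τ (of x • ω) ≠ of x * τ ω := he
      simp only [lift_apply_of, γ]
      rw [_root_.map_mul, _root_.map_mul, _root_.map_inv, Equiv.Perm.mul_apply,
        Equiv.Perm.mul_apply, hΦτ, hΦx, Equiv.Perm.inv_eq_iff_eq, hΦτ]
      simp [f, he']
    | inv_of e ih =>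
      intro y
      rw [_root_.map_inv, Subgroup.coe_inv, _root_.map_inv, Equiv.Perm.inv_eq_iff_eq, ih]
      simp
    | mul v w hv hw =>
      intro y
      rw [_root_.map_mul, Subgroup.coe_mul, _root_.map_mul, Equiv.Perm.mul_apply, hw, hv, mul_assoc]
  have hgen : ∀ (g : FreeGroup X) (ω : Ω), ⟨_, hcoset g ω⟩ ∈ (lift γ).range := by
    intro g
    induction g using FreeGroup.induction_on with
    | C1 =>
      intro ω
      convert one_mem (lift γ).range
      simp
    | of x =>
      intro ω
      by_cases h : τ (of x • ω) = of x * τ ω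
      · convert one_mem (lift γ).range
        simp [h]
      · exact ⟨of ⟨(x, ω), h⟩, by simp [γ]⟩
    | inv_of x ih =>
      intro ω
      convert inv_mem (ih ((of x)⁻¹ • ω))
      simp [mul_assoc]
    | mul v w hv hw =>
      intro ω
      convert mul_mem (hv (w • ω)) (hw ω)
      simp [mul_assoc, mul_smul]
  refine ⟨S, γ, ⟨?_, ?_⟩, ?_⟩
  · intro v w h
    have h1 := hΦγ v 1
    have h2 := hΦγ w 1
    rw [h, h2] at h1
    simpa using (Prod.ext_iff.1 h1).2.symm
  · rintro ⟨g, hg⟩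
    obtain ⟨w, hw⟩ := hgen g o
    refine ⟨w, hw.trans (Subtype.ext ?_)⟩
    have : τ o = 1 := hτ1
    simp [(hmemB g).1 hg, this]
  · intro x hx
    have ho : of x • o = o := (hmemB _).1 hx
    have h1 : τ o = 1 := hτ1
    refine ⟨⟨(x, o), ?_⟩, ?_⟩
    · simp [ho, h1, of_ne_one, eq_comm]
    · simp [γ, ho, h1]

end Schreier

end FreeGroup

end SchreierBasis

section Automorphisms

open Function

namespace FreeGroup

/-- The automorphism of a free group with prescribed values of it and of its inverse on the
generators. -/
def autOfLift {X : Type*} (f g : X → FreeGroup X) (hgf : ∀ i, lift g (f i) = of i)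
    (hfg : ∀ i, lift f (g i) = of i) : MulAut (FreeGroup X) :=
  MonoidHom.toMulEquiv (lift f) (lift g) (by ext i; simp [hgf]) (by ext i; simp [hfg])

section autOfLift

variable {X : Type*} {f g : X → FreeGroup X} {hgf : ∀ i, lift g (f i) = of i}
  {hfg : ∀ i, lift f (g i) = of i}

@[simp]
theorem autOfLift_of (i : X) : autOfLift f g hgf hfg (of i) = f i :=
  lift_apply_of

@[simp]
theorem autOfLift_inv_of (i : X) : (autOfLift f g hgf hfg)⁻¹ (of i) = g i :=
  lift_apply_of (f := g)

end autOfLift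

theorem mulAut_ext {X : Type*} {σ τ : MulAut (FreeGroup X)} (h : ∀ i, σ (of i) = τ (of i)) :
    σ = τ :=
  MulEquiv.toMonoidHom_injective (ext_hom _ _ h)

/-- The subgroup generated by the first `n` free generators. -/
def initial (n : ℕ) : Subgroup (FreeGroup ℕ) :=
  (map (Fin.val : Fin n → ℕ)).range

theorem of_mem_initial {n i : ℕ} (h : i < n) : of i ∈ initial n :=
  ⟨of ⟨i, h⟩, by simp⟩

theorem initial_le {n : ℕ} {K : Subgroup (FreeGroup ℕ)} :
    initial n ≤ K ↔ ∀ i < n, of i ∈ K := by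
  refine ⟨fun h i hi => h (of_mem_initial hi), fun h => ?_⟩
  rw [initial, map_eq_lift]
  rw [range_lift_eq_closure, Subgroup.closure_le]
  rintro _ ⟨i, rfl⟩
  exact h i i.2

theorem initial_mono : Monotone initial :=
  fun _ _ h => initial_le.2 fun _ hi => of_mem_initial (hi.trans_le h)

theorem exists_mem_initial (x : FreeGroup ℕ) : ∃ n, x ∈ initial n := by
  induction x using FreeGroup.induction_on with
  | C1 => exact ⟨0, one_mem _⟩
  | of i => exact ⟨i + 1, of_mem_initial i.lt_succ_self⟩
  | inv_of i h => exact h.imp fun n hn => inv_mem hn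
  | mul x y hx hy =>
    obtain ⟨n, hn⟩ := hx
    obtain ⟨m, hm⟩ := hy
    exact ⟨max n m, mul_mem (initial_mono (le_max_left _ _) hn)
      (initial_mono (le_max_right _ _) hm)⟩

theorem exists_forall_mem_initial (f : ℕ → FreeGroup ℕ) (r : ℕ) :
    ∃ n, r ≤ n ∧ ∀ i < r, f i ∈ initial n := by
  choose n hn using fun i => exists_mem_initial (f i)
  refine ⟨max r ((Finset.range r).sup n), le_max_left _ _, fun i hi => ?_⟩
  exact initial_mono ((Finset.le_sup (f := n) (Finset.mem_range.2 hi)).trans (le_max_right _ _))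
    (hn i)

theorem eqOn_initial {H : Type*} [Group H] {φ χ : FreeGroup ℕ →* H} {n : ℕ}
    (h : ∀ i < n, φ (of i) = χ (of i)) {x : FreeGroup ℕ} (hx : x ∈ initial n) : φ x = χ x :=
  (initial_le (K := φ.eqLocus χ)).2 h hx

theorem map_mem_initial {φ : FreeGroup ℕ →* FreeGroup ℕ} {n m : ℕ}
    (h : ∀ i < n, φ (of i) ∈ initial m) {x : FreeGroup ℕ} (hx : x ∈ initial n) :
    φ x ∈ initial m :=
  (initial_le (K := (initial m).comap φ)).2 h hx

/-- The automorphisms fixing the first `n` free generators. -/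
def fixing (n : ℕ) : Subgroup (MulAut (FreeGroup ℕ)) where
  carrier := {σ | ∀ i < n, σ (of i) = of i}
  one_mem' := fun _ _ => rfl
  mul_mem' := fun {σ τ} hσ hτ i hi => by rw [MulAut.mul_apply, hτ i hi, hσ i hi]
  inv_mem' := fun {σ} hσ i hi => by
    rw [MulAut.inv_apply, MulEquiv.symm_apply_eq, hσ i hi]

theorem mem_fixing {n : ℕ} {σ : MulAut (FreeGroup ℕ)} :
    σ ∈ fixing n ↔ ∀ i < n, σ (of i) = of i :=
  Iff.rfl

theorem inv_mul_mem_fixing {n : ℕ} {σ τ : MulAut (FreeGroup ℕ)} :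
    σ⁻¹ * τ ∈ fixing n ↔ ∀ i < n, σ (of i) = τ (of i) := by
  refine forall₂_congr fun i _ => ?_
  rw [MulAut.mul_apply, MulAut.inv_apply, MulEquiv.symm_apply_eq, eq_comm]

theorem apply_eq_of_mem_fixing {n : ℕ} {σ : MulAut (FreeGroup ℕ)} (h : σ ∈ fixing n)
    {x : FreeGroup ℕ} (hx : x ∈ initial n) : σ x = x :=
  eqOn_initial (φ := σ.toMonoidHom) (χ := MonoidHom.id _) h hx

/-- The automorphisms preserving the subgroup generated by the first `n` free generators. -/
def preserving (n : ℕ) : Subgroup (MulAut (FreeGroup ℕ)) where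
  carrier := {σ | ∀ x, σ x ∈ initial n ↔ x ∈ initial n}
  one_mem' := fun _ => Iff.rfl
  mul_mem' := fun {σ τ} hσ hτ x => (hσ (τ x)).trans (hτ x)
  inv_mem' := fun {σ} hσ x => by
    rw [← hσ (σ⁻¹ x), MulAut.apply_inv_self]

theorem mem_preserving_of_generators {n : ℕ} {σ : MulAut (FreeGroup ℕ)}
    (h : ∀ i < n, σ (of i) ∈ initial n) (h' : ∀ i < n, σ⁻¹ (of i) ∈ initial n) :
    σ ∈ preserving n := by
  refine fun x => ⟨fun hx => ?_, map_mem_initial (φ := σ.toMonoidHom) h⟩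
  have := map_mem_initial (φ := (σ⁻¹).toMonoidHom) h' hx
  simpa using this

theorem exists_equiv_extending {ι κ : Type*} {r : ℕ} (e : ι ≃ κ) (f : Fin r → ι) (g : Fin r → κ)
    (hf : Injective f) (hg : Injective g) : ∃ e' : ι ≃ κ, ∀ i, e' (f i) = g i := by
  obtain ⟨p, hp⟩ := Equiv.Perm.exists_extending_pair (e ∘ f) g (e.injective.comp hf) hg
  exact ⟨e.trans p, hp⟩

theorem lift_dite_map {m : ℕ} (α : MulAut (FreeGroup (Fin m))) (x : FreeGroup (Fin m)) :
    lift (fun i => if h : i < m then map Fin.val (α (of ⟨i, h⟩)) else of i)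
      (map (Fin.val : Fin m → ℕ) x) = map Fin.val (α x) := by
  refine DFunLike.congr_fun (f := (lift _).comp (map _))
    (g := (map Fin.val).comp α.toMonoidHom) (ext_hom _ _ fun i => ?_) x
  simp

/-- The extension of an automorphism of the free group of rank `m` fixing the remaining
generators. -/
def extendAut {m : ℕ} (α : MulAut (FreeGroup (Fin m))) : MulAut (FreeGroup ℕ) :=
  autOfLift (fun i => if h : i < m then map Fin.val (α (of ⟨i, h⟩)) else of i)
    (fun i => if h : i < m then map Fin.val (α⁻¹ (of ⟨i, h⟩)) else of i)
    (fun i => by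
      split_ifs with h
      · rw [lift_dite_map]; simp
      · simp [h])
    (fun i => by
      split_ifs with h
      · rw [lift_dite_map]; simp
      · simp [h])

theorem extendAut_of_lt {m i : ℕ} (α : MulAut (FreeGroup (Fin m))) (h : i < m) :
    extendAut α (of i) = map Fin.val (α (of ⟨i, h⟩)) := by
  simp [extendAut, h]

theorem extendAut_inv_of_lt {m i : ℕ} (α : MulAut (FreeGroup (Fin m))) (h : i < m) :
    (extendAut α)⁻¹ (of i) = map Fin.val (α⁻¹ (of ⟨i, h⟩)) := by
  simp only [extendAut, autOfLift_inv_of, dif_pos h]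

theorem extendAut_of_le {m i : ℕ} (α : MulAut (FreeGroup (Fin m))) (h : m ≤ i) :
    extendAut α (of i) = of i := by
  simp [extendAut, h.not_gt]

theorem extendAut_inv_of_le {m i : ℕ} (α : MulAut (FreeGroup (Fin m))) (h : m ≤ i) :
    (extendAut α)⁻¹ (of i) = of i := by
  simp only [extendAut, autOfLift_inv_of, dif_neg h.not_gt]

/-- Any automorphism agrees on the first `r` free generators with an automorphism which moves
only finitely many free generators. -/
theorem exists_finitary_agreeing (σ : MulAut (FreeGroup ℕ)) (r : ℕ) :
    ∃ L, r ≤ L ∧ ∃ q : MulAut (FreeGroup ℕ), (∀ i < r, q (of i) = σ (of i)) ∧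
      (∀ j, L ≤ j → q (of j) = of j) ∧ ∀ m, L ≤ m → q ∈ preserving m := by
  obtain ⟨m, hrm, hm⟩ := exists_forall_mem_initial (fun i => σ (of i)) r
  obtain ⟨ι, γ, hγ, hof⟩ := exists_subgroup_basis ((initial m).map σ.symm.toMonoidHom)
  have hinj : Injective (map (Fin.val : Fin m → ℕ)) := map_injective Fin.val_injective
  let E : FreeGroup ι ≃* FreeGroup (Fin m) := (MulEquiv.ofBijective (lift γ) hγ).trans
    ((σ.symm.subgroupMap (initial m)).symm.trans (MonoidHom.ofInjective hinj).symm)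
  have hE : ∀ y, map Fin.val (E y) = σ (lift γ y : FreeGroup ℕ) := by
    intro y
    obtain ⟨x, rfl⟩ := E.symm.surjective y
    rw [MulEquiv.apply_symm_apply]
    have : ((lift γ (E.symm x) : _) : FreeGroup ℕ) = σ.symm (map Fin.val x) := by
      have : lift γ (E.symm x) = σ.symm.subgroupMap (initial m) (MonoidHom.ofInjective hinj x) :=
        (MulEquiv.ofBijective (lift γ) hγ).apply_symm_apply _
      rw [this]; rfl
    rw [this, MulEquiv.apply_symm_apply]
  have hidx : ∀ i : Fin r, ∃ j, (γ j : FreeGroup ℕ) = of (i : ℕ) := fun i =>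
    hof i ⟨σ (of i), hm i i.2, by simp⟩
  choose j hj using hidx
  have hjinj : Injective j := fun a b hab => by
    have := hj a
    rw [hab, hj b] at this
    exact Fin.ext (of_injective this).symm
  obtain ⟨e, he⟩ := exists_equiv_extending (Equiv.ofFreeGroupEquiv E) j
    (fun i : Fin r => (⟨i, i.2.trans_le hrm⟩ : Fin m)) hjinj
    (fun a b hab => Fin.ext (by simpa using hab))
  let α : MulAut (FreeGroup (Fin m)) := (freeGroupCongr e.symm).trans E
  refine ⟨m, hrm, extendAut α, fun i hi => ?_, fun j hj => extendAut_of_le α hj, fun n hn => ?_⟩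
  · rw [extendAut_of_lt α (hi.trans_le hrm)]
    have : α (of ⟨i, hi.trans_le hrm⟩) = E (of (j ⟨i, hi⟩)) := by
      simp only [α, MulEquiv.trans_apply, freeGroupCongr_apply, map.of]
      rw [← he ⟨i, hi⟩, Equiv.symm_apply_apply]
    rw [this, hE, lift_apply_of, hj]
  · refine mem_preserving_of_generators (fun i hi => ?_) fun i hi => ?_
    · rcases lt_or_ge i m with h | h
      · rw [extendAut_of_lt α h]; exact initial_mono hn ⟨_, rfl⟩
      · rw [extendAut_of_le α h]; exact of_mem_initial hi
    · rcases lt_or_ge i m with h | h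
      · rw [extendAut_inv_of_lt α h]; exact initial_mono hn ⟨_, rfl⟩
      · rw [extendAut_inv_of_le α h]; exact of_mem_initial hi

end FreeGroup

end Automorphisms

section AutTopology

open Topology Filter Function

namespace FreeGroup

theorem freeGroupCongr_apply_of {X : Type*} (p : Equiv.Perm X) (i : X) :
    (freeGroupCongr p : MulAut (FreeGroup X)) (of i) = of (p i) := by
  simp

theorem freeGroupCongr_inv_apply_of {X : Type*} (p : Equiv.Perm X) (i : X) :
    (freeGroupCongr p : MulAut (FreeGroup X))⁻¹ (of i) = of (p⁻¹ i) :=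
  freeGroupCongr_apply_of p⁻¹ i

theorem inv_agree {n : ℕ} {a θ : MulAut (FreeGroup ℕ)} (hθ : θ ∈ preserving n)
    (h : ∀ i < n, θ (of i) = a (of i)) {i : ℕ} (hi : i < n) : θ⁻¹ (of i) = a⁻¹ (of i) := by
  have hmem : θ⁻¹ (of i) ∈ initial n := (inv_mem hθ (of i)).2 (of_mem_initial hi)
  have := eqOn_initial (φ := θ.toMonoidHom) (χ := a.toMonoidHom) h hmem
  have h2 : of i = a (θ⁻¹ (of i)) := by simpa using this
  rw [h2, MulAut.inv_apply_self, ← h2]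

section Amalgam

variable {n m l : ℕ} (p : Equiv.Perm ℕ) (a θ : MulAut (FreeGroup ℕ))

/-- The values on the generators of the amalgam of `a` and of a translate of `θ`. -/
def amalgamFun (m l n : ℕ) (p : Equiv.Perm ℕ) (a θ : MulAut (FreeGroup ℕ)) (i : ℕ) :
    FreeGroup ℕ :=
  if i < l then a (of i)
  else if i < l + (m - n) then freeGroupCongr p (θ (of (p⁻¹ i))) else of i

variable {p a θ}

theorem lift_amalgamFun_of_mem_initial {x : FreeGroup ℕ} (hx : x ∈ initial l) :
    lift (amalgamFun m l n p a θ) x = a x :=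
  eqOn_initial (χ := a.toMonoidHom) (fun i hi => by simp [amalgamFun, hi]) hx

theorem lift_amalgamFun_freeGroupCongr (hnl : n ≤ l) (hp : ∀ i < n, p i = i)
    (hp' : ∀ i, n ≤ i → i < m → p i = i - n + l) (hθ : θ ∈ preserving n)
    (h : ∀ i < n, θ (of i) = a (of i)) {x : FreeGroup ℕ} (hx : x ∈ initial m) :
    lift (amalgamFun m l n p a θ) (freeGroupCongr p x) = freeGroupCongr p (θ x) := by
  refine eqOn_initial (φ := (lift (amalgamFun m l n p a θ)).comp (freeGroupCongr p).toMonoidHom)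
    (χ := (freeGroupCongr p).toMonoidHom.comp θ.toMonoidHom) (fun i hi => ?_) hx
  simp only [MonoidHom.comp_apply, MulEquiv.coe_toMonoidHom]
  rw [freeGroupCongr_apply_of, lift_apply_of]
  rcases lt_or_ge i n with hin | hin
  · rw [hp i hin, amalgamFun, if_pos (hin.trans_le hnl), ← h i hin]
    refine (apply_eq_of_mem_fixing (n := n) (σ := freeGroupCongr p) (fun j hj => ?_) ?_).symm
    · rw [freeGroupCongr_apply_of, hp j hj]
    · exact (hθ _).2 (of_mem_initial hin)
  · have hpi := hp' i hin hi
    rw [amalgamFun, if_neg (by omega), if_pos (by omega), Equiv.Perm.coe_inv,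
      Equiv.symm_apply_apply]

theorem exists_amalgam (hnm : n ≤ m) (hnl : n ≤ l) (hp : ∀ i < n, p i = i)
    (hp' : ∀ i, n ≤ i → i < m → p i = i - n + l) (hθ : θ ∈ preserving n) (hθm : θ ∈ preserving m)
    (hal : a ∈ preserving l) (h : ∀ i < n, θ (of i) = a (of i)) :
    ∃ θ' ∈ preserving l, θ' ∈ preserving (l + (m - n)) ∧ (∀ i < l, θ' (of i) = a (of i)) ∧
      ∀ i < m, θ' (of (p i)) = freeGroupCongr p (θ (of i)) := by
  have hinv : ∀ i < n, θ⁻¹ (of i) = a⁻¹ (of i) := fun i hi => inv_agree hθ h hi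
  have hcancel : ∀ a θ : MulAut (FreeGroup ℕ), θ ∈ preserving n → θ ∈ preserving m →
      a ∈ preserving l → (∀ i < n, θ⁻¹ (of i) = a⁻¹ (of i)) → ∀ i,
      lift (amalgamFun m l n p a⁻¹ θ⁻¹) (amalgamFun m l n p a θ i) = of i := by
    intro a θ hθ hθm hal h i
    by_cases hi : i < l
    · rw [amalgamFun, if_pos hi,
        lift_amalgamFun_of_mem_initial ((hal _).2 (of_mem_initial hi)), MulAut.inv_apply_self]
    by_cases hi' : i < l + (m - n)
    · have hk : p⁻¹ i = i - l + n := by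
        rw [Equiv.Perm.inv_eq_iff_eq, hp' _ (by omega) (by omega)]
        omega
      have hk' : p⁻¹ i < m := by omega
      rw [amalgamFun, if_neg hi, if_pos hi', lift_amalgamFun_freeGroupCongr hnl hp hp'
        (inv_mem hθ) h ((hθm _).2 (of_mem_initial hk')), MulAut.inv_apply_self,
        freeGroupCongr_apply_of, Equiv.Perm.coe_inv, Equiv.apply_symm_apply]
    · rw [amalgamFun, if_neg hi, if_neg hi', lift_apply_of, amalgamFun, if_neg hi, if_neg hi']
  have hmem : ∀ a θ : MulAut (FreeGroup ℕ), θ ∈ preserving m →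
      a ∈ preserving l → ∀ i < l + (m - n),
      amalgamFun m l n p a θ i ∈ initial (l + (m - n)) := by
    intro a θ hθm hal i hi'
    by_cases hi : i < l
    · rw [amalgamFun, if_pos hi]
      exact initial_mono (by omega) ((hal _).2 (of_mem_initial hi))
    · have hk : p⁻¹ i = i - l + n := by
        rw [Equiv.Perm.inv_eq_iff_eq, hp' _ (by omega) (by omega)]
        omega
      have hk' : p⁻¹ i < m := by omega
      rw [amalgamFun, if_neg hi, if_pos hi']
      refine map_mem_initial (n := m) (φ := (freeGroupCongr p).toMonoidHom) (fun j hj => ?_)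
        ((hθm _).2 (of_mem_initial hk'))
      simp only [MulEquiv.coe_toMonoidHom]
      rw [freeGroupCongr_apply_of]
      apply of_mem_initial
      rcases lt_or_ge j n with hjn | hjn
      · rw [hp j hjn]; omega
      · rw [hp' j hjn hj]; omega
  let θ' : MulAut (FreeGroup ℕ) := autOfLift (amalgamFun m l n p a θ)
    (amalgamFun m l n p a⁻¹ θ⁻¹) (hcancel a θ hθ hθm hal hinv) (by
      have := hcancel a⁻¹ θ⁻¹ (inv_mem hθ) (inv_mem hθm) (inv_mem hal) (by simpa using h)
      simpa only [inv_inv] using this)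
  have hθ'a : ∀ i < l, θ' (of i) = a (of i) := fun i hi => by
    rw [autOfLift_of, amalgamFun, if_pos hi]
  refine ⟨θ', mem_preserving_of_generators (fun i hi => ?_) (fun i hi => ?_),
    mem_preserving_of_generators (fun i hi => ?_) (fun i hi => ?_), hθ'a, fun i hi => ?_⟩
  · rw [hθ'a i hi]
    exact (hal _).2 (of_mem_initial hi)
  · rw [autOfLift_inv_of, amalgamFun, if_pos hi]
    exact (inv_mem hal _).2 (of_mem_initial hi)
  · rw [autOfLift_of]
    exact hmem a θ hθm hal i hi
  · rw [autOfLift_inv_of]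
    exact hmem a⁻¹ θ⁻¹ (inv_mem hθm) (inv_mem hal) i hi
  · have := lift_amalgamFun_freeGroupCongr (l := l) (a := a) hnl hp hp' hθ h (of_mem_initial hi)
    rw [freeGroupCongr_apply_of] at this
    exact this

end Amalgam

theorem exists_eventually_eq (κ : ℕ → MulAut (FreeGroup ℕ))
    (h : ∀ i, ∀ᶠ j in atTop, κ j (of i) = κ (j + 1) (of i)) :
    ∃ f : ℕ → FreeGroup ℕ, ∀ x, ∀ᶠ j in atTop, κ j x = lift f x := by
  have : ∀ i, ∃ y, ∀ᶠ j in atTop, κ j (of i) = y := by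
    intro i
    obtain ⟨J, hJ⟩ := eventually_atTop.1 (h i)
    refine ⟨κ J (of i), eventually_atTop.2 ⟨J, fun j hj => ?_⟩⟩
    induction j, hj using Nat.le_induction with
    | base => rfl
    | succ j hj ih => rw [← hJ j hj, ih]
  choose f hf using this
  refine ⟨f, fun x => ?_⟩
  induction x using FreeGroup.induction_on with
  | C1 => simp
  | of i => simpa using hf i
  | inv_of i h =>
    filter_upwards [h] with j hj
    rw [_root_.map_inv, _root_.map_inv, hj]
  | mul x y hx hy =>
    filter_upwards [hx, hy] with j hj hj'
    rw [_root_.map_mul, _root_.map_mul, hj, hj']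

theorem exists_limit (κ : ℕ → MulAut (FreeGroup ℕ))
    (h : ∀ r, ∀ᶠ j in atTop, (κ j)⁻¹ * κ (j + 1) ∈ fixing r ∧ κ j * (κ (j + 1))⁻¹ ∈ fixing r) :
    ∃ k, ∀ r, ∀ᶠ j in atTop, (κ j)⁻¹ * k ∈ fixing r := by
  obtain ⟨f, hf⟩ := exists_eventually_eq κ fun i => (h (i + 1)).mono fun j hj =>
    inv_mul_mem_fixing.1 hj.1 i i.lt_succ_self
  obtain ⟨g, hg⟩ := exists_eventually_eq (fun j => (κ j)⁻¹) fun i => (h (i + 1)).mono fun j hj =>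
    inv_mul_mem_fixing.1 (by rw [inv_inv]; exact hj.2) i i.lt_succ_self
  refine ⟨autOfLift f g (fun i => ?_) fun i => ?_, fun r => ?_⟩
  · obtain ⟨j, h1, h2⟩ := ((hf (of i)).and (hg (f i))).exists
    rw [← h2, MulAut.inv_apply, MulEquiv.symm_apply_eq, h1, lift_apply_of]
  · obtain ⟨j, h1, h2⟩ := ((hg (of i)).and (hf (g i))).exists
    rw [lift_apply_of] at h1
    rw [← h2, ← h1, MulAut.apply_inv_self]
  · have := (eventually_all_finset (Finset.range r)).2 fun i _ => hf (of i)
    filter_upwards [this] with j hj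
    refine inv_mul_mem_fixing.2 fun i hi => ?_
    rw [hj i (Finset.mem_range.2 hi), autOfLift_of, lift_apply_of]

/-- The values of an automorphism and of its inverse on the generators. -/
def autValues (σ : MulAut (FreeGroup ℕ)) : (ℕ → FreeGroup ℕ) × (ℕ → FreeGroup ℕ) :=
  (fun i => σ (of i), fun i => σ⁻¹ (of i))

/-- The topology of pointwise convergence on the automorphism group. -/
@[reducible]
def autTopology : TopologicalSpace (MulAut (FreeGroup ℕ)) :=
  letI : TopologicalSpace (FreeGroup ℕ) := ⊥
  TopologicalSpace.induced autValues inferInstance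

section Topology

attribute [local instance] autTopology

local instance discreteTopology : TopologicalSpace (FreeGroup ℕ) := ⊥

local instance discreteTopology_spec : DiscreteTopology (FreeGroup ℕ) := ⟨rfl⟩

theorem continuous_apply_of (i : ℕ) : Continuous fun σ : MulAut (FreeGroup ℕ) => σ (of i) :=
  ((continuous_apply i).comp continuous_fst).comp (continuous_induced_dom (f := autValues))

theorem continuous_inv_apply_of (i : ℕ) : Continuous fun σ : MulAut (FreeGroup ℕ) => σ⁻¹ (of i) :=
  ((continuous_apply i).comp continuous_snd).comp (continuous_induced_dom (f := autValues))

theorem continuous_inv_aut : Continuous fun σ : MulAut (FreeGroup ℕ) => σ⁻¹ := by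
  refine continuous_induced_rng.2 (Continuous.prodMk ?_ ?_)
  · exact continuous_pi continuous_inv_apply_of
  · refine continuous_pi fun i => ?_
    simpa using continuous_apply_of i

theorem continuous_aut_apply (x : FreeGroup ℕ) :
    Continuous fun σ : MulAut (FreeGroup ℕ) => σ x := by
  induction x using FreeGroup.induction_on with
  | C1 => simpa using continuous_const
  | of i => exact continuous_apply_of i
  | inv_of i h => simp only [_root_.map_inv]; exact h.inv
  | mul x y hx hy => simp only [_root_.map_mul]; exact hx.mul hy

theorem continuous_eval :
    Continuous fun q : MulAut (FreeGroup ℕ) × FreeGroup ℕ => q.1 q.2 :=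
  continuous_prod_of_discrete_right.2 continuous_aut_apply

theorem isTopologicalGroup_aut : IsTopologicalGroup (MulAut (FreeGroup ℕ)) where
  continuous_inv := continuous_inv_aut
  continuous_mul := by
    refine continuous_induced_rng.2 (Continuous.prodMk ?_ ?_)
    · refine continuous_pi fun i => ?_
      exact continuous_eval.comp
        (continuous_fst.prodMk ((continuous_apply_of i).comp continuous_snd))
    · refine continuous_pi fun i => ?_
      simp only [mul_inv_rev, MulAut.mul_apply]
      exact continuous_eval.comp ((continuous_inv_aut.comp continuous_snd).prodMk
        ((continuous_inv_apply_of i).comp continuous_fst))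

theorem continuous_lift_apply (x : FreeGroup ℕ) :
    Continuous fun f : ℕ → FreeGroup ℕ => lift f x := by
  induction x using FreeGroup.induction_on with
  | C1 => simpa using continuous_const
  | of i => simpa using continuous_apply i
  | inv_of i h => simp only [_root_.map_inv]; exact h.inv
  | mul x y hx hy => simp only [_root_.map_mul]; exact hx.mul hy

theorem continuous_lift_eval :
    Continuous fun q : (ℕ → FreeGroup ℕ) × FreeGroup ℕ => lift q.1 q.2 :=
  continuous_prod_of_discrete_right.2 continuous_lift_apply

theorem range_autValues : Set.range autValues =
    {q | ∀ i, lift q.2 (q.1 i) = of i ∧ lift q.1 (q.2 i) = of i} := by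
  ext ⟨f, g⟩
  constructor
  · rintro ⟨σ, hσ⟩ i
    obtain ⟨rfl, rfl⟩ := Prod.mk.inj hσ
    have h : ∀ σ : MulAut (FreeGroup ℕ), ∀ x, lift (fun i => σ (of i)) x = σ x := fun σ x =>
      DFunLike.congr_fun (ext_hom (lift _) σ.toMonoidHom (by simp)) x
    simp only [h]
    simp
  · intro h
    refine ⟨autOfLift f g (fun i => (h i).1) fun i => (h i).2, ?_⟩
    ext i <;> simp only [autValues, autOfLift_of, autOfLift_inv_of]

theorem isCompletelyMetrizableSpace_aut :
    TopologicalSpace.IsCompletelyMetrizableSpace (MulAut (FreeGroup ℕ)) := by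
  have hcm : TopologicalSpace.IsCompletelyMetrizableSpace (FreeGroup ℕ) := inferInstance
  refine IsClosedEmbedding.IsCompletelyMetrizableSpace (f := autValues) ⟨⟨⟨rfl⟩, ?_⟩, ?_⟩
  · intro σ τ h
    exact mulAut_ext fun i => congr_fun (congr_arg Prod.fst h) i
  · rw [range_autValues]
    simp only [Set.ofPred_forall]
    refine isClosed_iInter fun i => (isClosed_eq ?_ continuous_const).inter
      (isClosed_eq ?_ continuous_const)
    · exact continuous_lift_eval.comp
        (continuous_snd.prodMk ((continuous_apply i).comp continuous_fst))
    · exact continuous_lift_eval.comp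
        (continuous_fst.prodMk ((continuous_apply i).comp continuous_snd))

theorem isOpen_fixing (n : ℕ) : IsOpen (fixing n : Set (MulAut (FreeGroup ℕ))) := by
  have : (fixing n : Set (MulAut (FreeGroup ℕ))) =
      ⋂ i ∈ Finset.range n, (fun σ : MulAut (FreeGroup ℕ) => σ (of i)) ⁻¹' {of i} := by
    ext σ
    simp [mem_fixing]
  rw [this]
  exact isOpen_biInter_finset fun i _ => (isOpen_discrete _).preimage (continuous_apply_of i)

theorem exists_fixing_subset {s : Set (MulAut (FreeGroup ℕ))} (hs : s ∈ 𝓝 1) :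
    ∃ n, (fixing n : Set (MulAut (FreeGroup ℕ))) ⊆ s := by
  rw [nhds_induced, mem_comap] at hs
  obtain ⟨V, hV, hVs⟩ := hs
  rw [nhds_prod_eq, mem_prod_iff] at hV
  obtain ⟨V₁, hV₁, V₂, hV₂, hV⟩ := hV
  rw [nhds_pi, Filter.mem_pi] at hV₁ hV₂
  obtain ⟨I₁, hI₁, W₁, hW₁, h₁⟩ := hV₁
  obtain ⟨I₂, hI₂, W₂, hW₂, h₂⟩ := hV₂
  obtain ⟨n, hn⟩ := (hI₁.union hI₂).bddAbove
  refine ⟨n + 1, fun σ hσ => hVs (hV ⟨h₁ fun i hi => ?_, h₂ fun i hi => ?_⟩)⟩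
  · have : σ (of i) = of i := hσ i (Nat.lt_succ_of_le (hn (Or.inl hi)))
    simp only [autValues, this]
    exact mem_of_mem_nhds (hW₁ i)
  · have : σ⁻¹ (of i) = of i := inv_mem hσ i (Nat.lt_succ_of_le (hn (Or.inr hi)))
    simp only [autValues, this]
    exact mem_of_mem_nhds (hW₂ i)

theorem amalgamationChain_aut : AmalgamationChain fixing preserving where
  anti := fun n m h σ hσ i hi => hσ i (hi.trans_le h)
  isOpen := isOpen_fixing
  basis := fun s hs => exists_fixing_subset hs
  le := fun n σ hσ => mem_preserving_of_generators
    (fun i hi => by rw [hσ i hi]; exact of_mem_initial hi)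
    (fun i hi => by rw [inv_mem hσ i hi]; exact of_mem_initial hi)
  normalizes := fun n p hp u hu i hi => by
    have h : p⁻¹ (of i) ∈ initial n := (inv_mem hp _).2 (of_mem_initial hi)
    rw [MulAut.mul_apply, MulAut.mul_apply, apply_eq_of_mem_fixing hu h, MulAut.apply_inv_self]
  countable := fun n => by
    have : Countable (Fin n → FreeGroup ℕ) := inferInstance
    refine Injective.countable (β := Fin n → FreeGroup ℕ)
      (f := Quotient.lift (fun σ (i : Fin n) => σ (of (i : ℕ))) fun σ τ h => ?_) ?_
    · rw [← Quotient.eq_iff_equiv] at h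
      exact funext fun i => inv_mul_mem_fixing.1 (QuotientGroup.eq.1 h) i i.2
    · rintro ⟨σ⟩ ⟨τ⟩ h
      exact QuotientGroup.eq.2 (inv_mul_mem_fixing.2 fun i hi => congr_fun h ⟨i, hi⟩)
  approx := fun x r => by
    obtain ⟨L, hL, q, hq, -, hqP⟩ := exists_finitary_agreeing x r
    exact ⟨L, hL, fun m hm => ⟨q, hqP m hm, inv_mul_mem_fixing.2 hq⟩⟩
  amalg := fun n m l hnm hnl => by
    obtain ⟨p, hp⟩ := Equiv.Perm.exists_extending_pair (fun i : Fin m => (i : ℕ))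
      (fun i => if (i : ℕ) < n then (i : ℕ) else i - n + l) Fin.val_injective (fun a b hab => by
        dsimp only at hab
        apply Fin.ext
        split_ifs at hab <;> omega)
    have hp₁ : ∀ i < n, p i = i := fun i hi => by
      have := hp ⟨i, hi.trans_le hnm⟩
      simpa [hi] using this
    have hp₂ : ∀ i, n ≤ i → i < m → p i = i - n + l := fun i hi hi' => by
      have := hp ⟨i, hi'⟩
      simpa [hi.not_gt] using this
    refine ⟨l + (m - n), by omega, freeGroupCongr p, fun i hi => ?_, fun x hx i hi => ?_,
      fun θ hθ hθm a _ hal h => ?_⟩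
    · rw [freeGroupCongr_apply_of, hp₁ i hi]
    · rw [MulAut.mul_apply, MulAut.mul_apply, freeGroupCongr_apply_of, hx,
        ← freeGroupCongr_apply_of,
        MulAut.inv_apply_self]
      rcases lt_or_ge i n with hin | hin
      · rw [hp₁ i hin]; omega
      · rw [hp₂ i hin hi]; omega
    · obtain ⟨θ', h1, h2, h3, h4⟩ := exists_amalgam hnm hnl hp₁ hp₂ hθ hθm hal
        (inv_mul_mem_fixing.1 h)
      refine ⟨θ', h1, h2, inv_mul_mem_fixing.2 h3, inv_mul_mem_fixing.2 fun i hi => ?_⟩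
      rw [MulAut.mul_apply, MulAut.mul_apply, freeGroupCongr_apply_of, h4 i hi]
      exact (MulAut.inv_apply_self _ (freeGroupCongr p : MulAut (FreeGroup ℕ)) _).symm
  complete := exists_limit

/-- The small index property for the automorphism group of the free group of countably infinite
rank. -/
theorem exists_fixing_le_of_index_lt_continuum {H : Subgroup (MulAut (FreeGroup ℕ))}
    (hH : Cardinal.mk (MulAut (FreeGroup ℕ) ⧸ H) < Cardinal.continuum) :
    ∃ n, fixing n ≤ H :=
  haveI := isTopologicalGroup_aut
  haveI := isCompletelyMetrizableSpace_aut
  amalgamationChain_aut.exists_le_of_index_lt_continuum hH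

end Topology

end FreeGroup

end AutTopology

section Words

open Function

namespace FreeGroup

theorem lift_mk_flatten {X Y : Type*} {f : X → FreeGroup Y} {φ : X × Bool → List (Y × Bool)}
    (htrue : ∀ i, mk (φ (i, true)) = f i) (hfalse : ∀ i, mk (φ (i, false)) = (f i)⁻¹)
    (L : List (X × Bool)) : lift f (mk L) = mk (L.map φ).flatten := by
  induction L with
  | nil => rw [← one_eq_mk, _root_.map_one]; rfl
  | cons a L ih =>
    have h : mk (a :: L) = mk [a] * mk L := by rw [mul_mk]; rfl
    rw [h, _root_.map_mul, ih, List.map_cons, List.flatten_cons, ← mul_mk]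
    congr 1
    obtain ⟨i, _ | _⟩ := a
    · rw [hfalse, lift_mk]; simp
    · rw [htrue, lift_mk]; simp

theorem toWord_mk_of_isReduced {X : Type*} [DecidableEq X] {L : List (X × Bool)}
    (h : IsReduced L) : (mk L).toWord = L := by
  rw [toWord_mk, isReduced_iff_reduce_eq.1 h]

theorem eq_one_of_commute_of {X : Type*} [DecidableEq X] {g : FreeGroup X} {k : X}
    (hk : ∀ a ∈ g.toWord, a.1 ≠ k) (h : g * of k = of k * g) : g = 1 := by
  have h1 : IsReduced (g.toWord ++ [(k, true)]) := by
    refine List.isChain_append.2 ⟨isReduced_toWord, List.isChain_singleton _, ?_⟩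
    intro x hx y hy hxy
    obtain rfl : (k, true) = y := by simpa using hy
    exact absurd hxy (hk x (List.mem_of_mem_getLast? hx))
  have h2 : IsReduced ((k, true) :: g.toWord) := by
    refine List.isChain_cons.2 ⟨?_, isReduced_toWord⟩
    intro x hx hxy
    exact absurd hxy.symm (hk x (List.mem_of_mem_head? hx))
  have h3 : g.toWord ++ [(k, true)] = (k, true) :: g.toWord := by
    rw [← toWord_mk_of_isReduced h1, ← toWord_mk_of_isReduced h2, ← mul_mk, mk_toWord]
    change (g * of k).toWord = _
    rw [h]
    congr 1
    conv_lhs => rw [← mk_toWord (x := g)]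
    rw [of, mul_mk]
    rfl
  rcases hL : g.toWord with _ | ⟨a, L⟩
  · exact toWord_eq_nil_iff.1 hL
  · rw [hL, List.cons_append] at h3
    have : a = (k, true) := (List.cons.inj h3).1
    exact absurd (by rw [this]) (hk a (by simp [hL]))

theorem eq_one_of_conj_eq_one {g : FreeGroup ℕ} (h : MulAut.conj g = 1) : g = 1 := by
  obtain ⟨k, hk⟩ := Infinite.exists_notMem_finset (g.toWord.map Prod.fst).toFinset
  refine eq_one_of_commute_of (k := k) (fun a ha hak => hk ?_) ?_
  · exact List.mem_toFinset.2 (List.mem_map.2 ⟨a, ha, hak⟩)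
  · have := DFunLike.congr_fun h (of k)
    rw [MulAut.conj_apply, MulAut.one_apply] at this
    exact mul_inv_eq_iff_eq_mul.1 this

/-- The involution of the letters which inverts the letter `0`. -/
def flipLetter (a : ℕ × Bool) : ℕ × Bool :=
  (a.1, if a.1 = 0 then !a.2 else a.2)

/-- The extremal involution which inverts the first free generator and fixes the others. -/
def stdInvolution : MulAut (FreeGroup ℕ) :=
  autOfLift (fun i => if i = 0 then (of i)⁻¹ else of i) (fun i => if i = 0 then (of i)⁻¹ else of i)
    (fun i => by split_ifs with h <;> simp [h]) (fun i => by split_ifs with h <;> simp [h])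

theorem stdInvolution_of_zero : stdInvolution (of 0) = (of 0)⁻¹ := by
  simp [stdInvolution]

theorem stdInvolution_of_ne {i : ℕ} (h : i ≠ 0) : stdInvolution (of i) = of i := by
  simp [stdInvolution, h]

theorem stdInvolution_mul_self : stdInvolution * stdInvolution = 1 :=
  mulAut_ext fun i => by
    rcases eq_or_ne i 0 with rfl | h
    · simp [stdInvolution_of_zero]
    · simp [stdInvolution_of_ne h]

theorem stdInvolution_mk (L : List (ℕ × Bool)) : stdInvolution (mk L) = mk (L.map flipLetter) := by
  have h : ∀ L : List (ℕ × Bool), L.map flipLetter = (L.map fun a => [flipLetter a]).flatten := by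
    intro L
    induction L with
    | nil => rfl
    | cons a L ih => simp [ih]
  rw [h]
  refine lift_mk_flatten (f := fun i => if i = 0 then (of i)⁻¹ else of i) (fun i => ?_)
    (fun i => ?_) L
  · split_ifs with hi <;> simp [flipLetter, hi, of, inv_mk, invRev]
  · split_ifs with hi <;> simp [flipLetter, hi, of, inv_mk, invRev]

theorem toWord_stdInvolution (g : FreeGroup ℕ) :
    (stdInvolution g).toWord = g.toWord.map flipLetter := by
  conv_lhs => rw [← mk_toWord (x := g), stdInvolution_mk]
  refine toWord_mk_of_isReduced (List.isChain_map_of_isChain _ (fun a b h => ?_) isReduced_toWord)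
  intro hab
  simp only [flipLetter] at hab ⊢
  rw [hab, h hab]

theorem map_flipLetter_eq_invRev {g : FreeGroup ℕ} (h : stdInvolution g = g⁻¹) :
    g.toWord.map flipLetter = invRev g.toWord := by
  rw [← toWord_stdInvolution, h, toWord_inv]

theorem flipLetter_cons_append {a b : ℕ × Bool} {M : List (ℕ × Bool)}
    (h : (a :: (M ++ [b])).map flipLetter = invRev (a :: (M ++ [b]))) :
    flipLetter a = (b.1, !b.2) ∧ M.map flipLetter = invRev M := by
  simp only [invRev, List.map_cons, List.map_append, List.map_nil, List.reverse_cons,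
    List.reverse_append, List.reverse_nil, List.nil_append, List.cons_append] at h
  obtain ⟨h1, h2⟩ := List.cons.inj h
  exact ⟨h1, (List.append_inj' h2 rfl).1⟩

theorem mk_cons_append {X : Type*} (a b : X × Bool) (M : List (X × Bool)) :
    mk (a :: (M ++ [b])) = mk [a] * mk M * mk [b] := by
  rw [mul_mk, mul_mk]; rfl

theorem mk_singleton_eq {X : Type*} (b : X × Bool) : mk [b] = (mk [(b.1, !b.2)])⁻¹ := by
  simp [inv_mk, invRev]

/-- Twisted cocycles of the standard involution. -/
theorem exists_eq_of_flipLetter (L : List (ℕ × Bool)) (h : L.map flipLetter = invRev L) :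
    ∃ v, mk L = v * (stdInvolution v)⁻¹ ∨ mk L = v * of 0 * (stdInvolution v)⁻¹ := by
  induction L using List.bidirectionalRec with
  | nil => exact ⟨1, Or.inl (by rw [_root_.map_one, inv_one, mul_one]; rfl)⟩
  | singleton a =>
    obtain ⟨i, b⟩ := a
    have hi : i = 0 := by
      by_contra hi
      simp [flipLetter, invRev, hi] at h
    subst hi
    cases b with
    | false =>
      refine ⟨(of 0)⁻¹, Or.inr ?_⟩
      rw [_root_.map_inv, stdInvolution_of_zero, inv_mul_cancel, one_mul, inv_inv]
      simp [of, inv_mk, invRev]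
    | true => exact ⟨1, Or.inr (by rw [_root_.map_one, inv_one, mul_one, one_mul]; rfl)⟩
  | cons_append a M b ih =>
    obtain ⟨hab, hM⟩ := flipLetter_cons_append h
    have hb : mk [b] = (stdInvolution (mk [a]))⁻¹ := by
      rw [mk_singleton_eq, ← hab, stdInvolution_mk]; rfl
    obtain ⟨v, hv⟩ := ih hM
    refine ⟨mk [a] * v, hv.imp (fun hv => ?_) fun hv => ?_⟩
    · rw [mk_cons_append, hb, hv, _root_.map_mul]; group
    · rw [mk_cons_append, hb, hv, _root_.map_mul]; group

theorem exists_eq_mul_inv {g : FreeGroup ℕ} (h : g * stdInvolution g = 1) :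
    ∃ v, g = v * (stdInvolution v)⁻¹ ∨ g = v * of 0 * (stdInvolution v)⁻¹ := by
  have := exists_eq_of_flipLetter g.toWord (map_flipLetter_eq_invRev (eq_inv_of_mul_eq_one_right h))
  rwa [mk_toWord] at this

theorem exists_conj_of_flipLetter (L : List (ℕ × Bool)) (hL : IsReduced L)
    (h : L.map flipLetter = invRev L) :
    mk L = 1 ∨ ∃ (c : FreeGroup ℕ) (W : List (ℕ × Bool)) (ε : Bool), stdInvolution c = c ∧
      IsReduced W ∧ W.head? = some (0, ε) ∧ W.getLast? = some (0, ε) ∧ mk L = c * mk W * c⁻¹ := by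
  induction L using List.bidirectionalRec with
  | nil => exact Or.inl rfl
  | singleton a =>
    obtain ⟨i, b⟩ := a
    have hi : i = 0 := by
      by_contra hi
      simp [flipLetter, invRev, hi] at h
    subst hi
    exact Or.inr ⟨1, [(0, b)], b, by simp, hL, rfl, rfl, by simp⟩
  | cons_append a M b ih =>
    obtain ⟨hab, hM⟩ := flipLetter_cons_append h
    by_cases ha : a.1 = 0
    · have hb : b = a := by
        simp only [flipLetter, ha, if_true, Prod.mk.injEq] at hab
        exact Prod.ext (hab.1.symm.trans ha.symm) (Bool.not_inj hab.2).symm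
      subst hb
      have hb' : b = (0, b.2) := Prod.ext ha rfl
      refine Or.inr ⟨1, b :: (M ++ [b]), b.2, by simp, hL, ?_, ?_, by simp⟩
      · rw [← hb']; rfl
      · rw [← hb', ← List.cons_append, List.getLast?_concat]
    · have hfa : flipLetter a = a := by simp [flipLetter, ha]
      have hb : mk [b] = (mk [a])⁻¹ := by rw [mk_singleton_eq, ← hab, hfa]
      have hMr : IsReduced M := hL.infix ⟨[a], [b], by simp⟩
      rcases ih hMr hM with hM1 | ⟨c, W, ε, hc, hW, hWh, hWl, hMW⟩
      · left
        rw [mk_cons_append, hM1, hb]; group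
      · refine Or.inr ⟨mk [a] * c, W, ε, ?_, hW, hWh, hWl, ?_⟩
        · rw [_root_.map_mul, hc, stdInvolution_mk, List.map_singleton, hfa]
        · rw [mk_cons_append, hMW, hb]; group

theorem mem_closure_of_stdInvolution_eq {g : FreeGroup ℕ} (h : stdInvolution g = g) :
    g ∈ Subgroup.closure (of '' {i : ℕ | i ≠ 0}) := by
  have hw : g.toWord.map flipLetter = g.toWord := by rw [← toWord_stdInvolution, h]
  rw [← mk_toWord (x := g)]
  generalize g.toWord = L at hw
  induction L with
  | nil => exact one_mem _
  | cons a L ih =>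
    obtain ⟨h1, h2⟩ := List.cons.inj hw
    have hm : mk (a :: L) = mk [a] * mk L := by rw [mul_mk]; rfl
    rw [hm]
    refine mul_mem ?_ (ih h2)
    obtain ⟨i, b⟩ := a
    have hi : i ≠ 0 := by
      rintro rfl
      simp [flipLetter] at h1
    have := Subgroup.subset_closure (k := of '' {i : ℕ | i ≠ 0}) ⟨i, hi, rfl⟩
    cases b with
    | true => exact this
    | false =>
      have h' : mk [(i, false)] = (of i)⁻¹ := by simp [of, inv_mk, invRev]
      rw [h']
      exact inv_mem this

/-- Substitution of a reduced word with equal end letters `(0, ε)` for the letter `0`. -/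
def substLetter (W : List (ℕ × Bool)) (a : ℕ × Bool) : List (ℕ × Bool) :=
  if a.1 = 0 then (if a.2 then W else invRev W) else [a]

/-- The common first and last letter of the word substituted for a letter. -/
def substEnd (ε : Bool) (a : ℕ × Bool) : ℕ × Bool :=
  (a.1, if a.1 = 0 then (a.2 == ε) else a.2)

theorem head?_substLetter {W : List (ℕ × Bool)} {ε : Bool} (hWh : W.head? = some (0, ε))
    (hWl : W.getLast? = some (0, ε)) (a : ℕ × Bool) :
    (substLetter W a).head? = some (substEnd ε a) := by
  obtain ⟨i, b⟩ := a
  by_cases hi : i = 0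
  · subst hi
    cases b
    · simp [substLetter, substEnd, invRev, hWl]
    · simp [substLetter, substEnd, hWh]
  · simp [substLetter, substEnd, hi]

theorem getLast?_substLetter {W : List (ℕ × Bool)} {ε : Bool} (hWh : W.head? = some (0, ε))
    (hWl : W.getLast? = some (0, ε)) (a : ℕ × Bool) :
    (substLetter W a).getLast? = some (substEnd ε a) := by
  obtain ⟨i, b⟩ := a
  by_cases hi : i = 0
  · subst hi
    cases b
    · simp [substLetter, substEnd, invRev, hWh]
    · simp [substLetter, substEnd, hWl]
  · simp [substLetter, substEnd, hi]

theorem isReduced_invRev {X : Type*} [DecidableEq X] {W : List (X × Bool)} (hW : IsReduced W) :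
    IsReduced (invRev W) := by
  have : invRev W = (mk W)⁻¹.toWord := by rw [toWord_inv, toWord_mk_of_isReduced hW]
  rw [this]
  exact isReduced_toWord

theorem isReduced_flatten_substLetter {W : List (ℕ × Bool)} {ε : Bool} (hW : IsReduced W)
    (hWh : W.head? = some (0, ε)) (hWl : W.getLast? = some (0, ε)) {L : List (ℕ × Bool)}
    (hL : IsReduced L) : IsReduced (L.map (substLetter W)).flatten := by
  rw [IsReduced, List.isChain_flatten]
  · refine ⟨?_, List.isChain_map_of_isChain _ (fun a b hab x hx y hy hxy => ?_) hL⟩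
    · intro l hl
      obtain ⟨a, -, rfl⟩ := List.mem_map.1 hl
      simp only [substLetter]
      split_ifs
      exacts [hW, isReduced_invRev hW, List.isChain_singleton _]
    · rw [getLast?_substLetter hWh hWl, Option.mem_some_iff] at hx
      rw [head?_substLetter hWh hWl, Option.mem_some_iff] at hy
      subst hx hy
      simp only [substEnd] at hxy ⊢
      rw [hxy, hab hxy]
  · intro h
    obtain ⟨a, -, ha⟩ := List.mem_map.1 h
    have := head?_substLetter hWh hWl a
    simp [ha] at this

theorem lift_mk_substLetter (W L : List (ℕ × Bool)) :
    lift (fun i => if i = 0 then mk W else of i) (mk L) = mk (L.map (substLetter W)).flatten := by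
  refine lift_mk_flatten (fun i => ?_) (fun i => ?_) L
  · by_cases hi : i = 0 <;> simp [substLetter, hi, of]
  · by_cases hi : i = 0 <;> simp [substLetter, hi, of, inv_mk] <;> simp [invRev]

theorem eq_singleton_of_lift_eq {W : List (ℕ × Bool)} {ε : Bool} (hW : IsReduced W)
    (hWh : W.head? = some (0, ε)) (hWl : W.getLast? = some (0, ε)) {g : FreeGroup ℕ}
    (hg : lift (fun i => if i = 0 then mk W else of i) g = of 0) : W = [(0, ε)] := by
  have hflat : (g.toWord.map (substLetter W)).flatten = [(0, true)] := by
    rw [← toWord_mk_of_isReduced (isReduced_flatten_substLetter hW hWh hWl isReduced_toWord),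
      ← lift_mk_substLetter, mk_toWord, hg, toWord_of]
  have hlen : W.length = 1 := by
    rcases hgw : g.toWord with _ | ⟨a, L⟩
    · simp [hgw] at hflat
    · rw [hgw, List.map_cons, List.flatten_cons, List.append_eq_singleton_iff] at hflat
      obtain ⟨h, -⟩ | ⟨h, -⟩ := hflat
      · have := head?_substLetter hWh hWl a
        simp [h] at this
      · simp only [substLetter] at h
        split_ifs at h with h1 h2
        · simp [h]
        · rw [← invRev_length, h]; rfl
        · exact absurd (congr_arg Prod.fst (List.cons.inj h).1) h1
  obtain ⟨w, rfl⟩ := List.length_eq_one_iff.1 hlen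
  simpa using hWh

end FreeGroup

end Words

section Centralizer

open Function

namespace FreeGroup

section Parity

/-- The parity of the rotation index, as a homomorphism on the dihedral group of order eight. -/
def dihedralParity : DihedralGroup 4 →* Multiplicative (ZMod 2) :=
  MonoidHom.mk' (fun d => match d with
    | .r i => .ofAdd (i.val : ZMod 2)
    | .sr i => .ofAdd (i.val : ZMod 2)) (by decide)

theorem dihedralParity_eq_one {d : DihedralGroup 4}
    (h : d * .sr 0 = .sr 0 * d) : dihedralParity d = 1 := by
  revert d
  decide

theorem eq_ofAdd_one_of_ne_one {y : Multiplicative (ZMod 2)} (h : y ≠ 1) : y = .ofAdd 1 := by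
  revert y
  decide

/-- The exponent sum of the first free generator. -/
def exponentZero : FreeGroup ℕ →* Multiplicative ℤ :=
  lift fun i => if i = 0 then .ofAdd 1 else 1

theorem exponentZero_stdInvolution (x : FreeGroup ℕ) :
    exponentZero (stdInvolution x) = (exponentZero x)⁻¹ := by
  refine DFunLike.congr_fun (f := exponentZero.comp stdInvolution.toMonoidHom)
    (g := exponentZero⁻¹) (ext_hom _ _ fun i => ?_) x
  rcases eq_or_ne i 0 with rfl | h
  · simp [stdInvolution_of_zero]
  · simp [stdInvolution_of_ne h, exponentZero, h]

open Classical in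
/-- A homomorphism to the dihedral group of order eight mapping the first free generator to one
reflection, and the other free generators to powers of another, as prescribed by `χ`. -/
noncomputable def dihedralHom (χ : FreeGroup ℕ →* Multiplicative (ZMod 2)) :
    FreeGroup ℕ →* DihedralGroup 4 :=
  lift fun i => if i = 0 then .sr 0 else if χ (of i) = 1 then 1 else .sr 1

theorem dihedralHom_stdInvolution (χ : FreeGroup ℕ →* Multiplicative (ZMod 2)) (x : FreeGroup ℕ) :
    dihedralHom χ (stdInvolution x) = dihedralHom χ x := by
  refine DFunLike.congr_fun (f := (dihedralHom χ).comp stdInvolution.toMonoidHom)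
    (g := dihedralHom χ) (ext_hom _ _ fun i => ?_) x
  rcases eq_or_ne i 0 with rfl | h
  · simp [stdInvolution_of_zero, dihedralHom]
  · simp [stdInvolution_of_ne h]

theorem eq_zpow_mul_dihedralParity (χ : FreeGroup ℕ →* Multiplicative (ZMod 2)) (x : FreeGroup ℕ) :
    χ x = χ (of 0) ^ (exponentZero x).toAdd * dihedralParity (dihedralHom χ x) := by
  refine DFunLike.congr_fun (f := χ) (g := (zpowersHom _ (χ (of 0))).comp exponentZero *
    dihedralParity.comp (dihedralHom χ)) (ext_hom _ _ fun i => ?_) x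
  rcases eq_or_ne i 0 with rfl | h
  · have : dihedralParity (.sr 0) = 1 := by decide
    simp [exponentZero, dihedralHom, this]
  · by_cases hi : χ (of i) = 1
    · simp [exponentZero, dihedralHom, h, hi]
    · have : dihedralParity (.sr 1) = .ofAdd 1 := by decide
      simp [exponentZero, dihedralHom, h, this, eq_ofAdd_one_of_ne_one hi]

theorem apply_eq_one_of_mul_of_zero {x : FreeGroup ℕ} (h : x * of 0 = of 0 * stdInvolution x)
    (χ : FreeGroup ℕ →* Multiplicative (ZMod 2)) : χ x = 1 := by
  have he : (exponentZero x).toAdd = 0 := by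
    have := congr_arg (fun y => (exponentZero y).toAdd) h
    simp only [_root_.map_mul, exponentZero_stdInvolution, toAdd_mul, toAdd_inv] at this
    omega
  have hd : dihedralHom χ x * .sr 0 = .sr 0 * dihedralHom χ x := by
    have := congr_arg (dihedralHom χ) h
    rw [_root_.map_mul, _root_.map_mul, dihedralHom_stdInvolution] at this
    simpa [dihedralHom] using this
  rw [eq_zpow_mul_dihedralParity χ x, he, dihedralParity_eq_one hd, zpow_zero, one_mul]

end Parity

theorem aut_mul_conj (σ : MulAut (FreeGroup ℕ)) (g : FreeGroup ℕ) :
    σ * MulAut.conj g = MulAut.conj (σ g) * σ := by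
  ext x
  simp

theorem not_mul_stdInvolution_eq (σ : MulAut (FreeGroup ℕ)) :
    σ * stdInvolution ≠ MulAut.conj (of 0) * stdInvolution * σ := by
  intro h
  have h1 := DFunLike.congr_fun h (of 1)
  simp only [MulAut.mul_apply, stdInvolution_of_ne one_ne_zero, MulAut.conj_apply] at h1
  have := apply_eq_one_of_mul_of_zero (x := σ (of 1)) (eq_mul_inv_iff_mul_eq.1 h1)
    ((lift fun i => if i = 1 then Multiplicative.ofAdd (1 : ZMod 2) else 1).comp
      (σ⁻¹).toMonoidHom)
  simp at this

theorem exists_zpow_conj_of_commute {σ : MulAut (FreeGroup ℕ)}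
    (h : σ * stdInvolution = stdInvolution * σ) :
    ∃ (a : ℤˣ), IsConj (σ (of 0)) (of 0 ^ (a : ℤ)) := by
  have happ : ∀ x, σ (stdInvolution x) = stdInvolution (σ x) := DFunLike.congr_fun h
  have hs : stdInvolution (σ (of 0)) = (σ (of 0))⁻¹ := by
    rw [← happ, stdInvolution_of_zero, _root_.map_inv]
  obtain h1 | ⟨c, W, ε, hc, hW, hWh, hWl, hcW⟩ :=
    exists_conj_of_flipLetter _ isReduced_toWord (map_flipLetter_eq_invRev hs)
  · rw [mk_toWord, map_eq_one_iff σ σ.injective] at h1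
    exact absurd h1 (of_ne_one 0)
  rw [mk_toWord] at hcW
  let τ := lift fun i => if i = 0 then mk W else of i
  have hC : Subgroup.closure (of '' {i : ℕ | i ≠ 0}) ≤ τ.range := by
    rw [Subgroup.closure_le]
    rintro _ ⟨i, hi, rfl⟩
    exact ⟨of i, by rw [lift_apply_of, if_neg hi]⟩
  have hrange : (MulAut.conj c⁻¹ * σ : MulAut (FreeGroup ℕ)).toMonoidHom.range ≤ τ.range := by
    rw [MonoidHom.range_eq_map, ← closure_range_of, MonoidHom.map_closure, Subgroup.closure_le]
    rintro _ ⟨_, ⟨i, rfl⟩, rfl⟩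
    rcases eq_or_ne i 0 with rfl | hi
    · refine ⟨of 0, ?_⟩
      simp [τ, hcW, mul_assoc]
    · refine hC (mem_closure_of_stdInvolution_eq ?_)
      simp [hc, ← happ, stdInvolution_of_ne hi]
  obtain ⟨g, hg⟩ := hrange ⟨(MulAut.conj c⁻¹ * σ : MulAut (FreeGroup ℕ))⁻¹ (of 0),
    MulAut.apply_inv_self _ _ _⟩
  have hWε := eq_singleton_of_lift_eq hW hWh hWl hg
  refine ⟨if ε then 1 else -1, isConj_iff.2 ⟨c⁻¹, ?_⟩⟩
  rw [hcW, hWε]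
  cases ε
  · simp [mul_assoc, of, inv_mk, invRev]
  · simp [mul_assoc, of]

theorem exists_zpow_conj_of_toOut_commute {σ : MulAut (FreeGroup ℕ)}
    (h : toOut σ * toOut stdInvolution = toOut stdInvolution * toOut σ) :
    ∃ (a : ℤˣ), IsConj (σ (of 0)) (of 0 ^ (a : ℤ)) := by
  have h' : toOut (stdInvolution * σ) = toOut (σ * stdInvolution) := by
    rw [_root_.map_mul, _root_.map_mul, h]
  obtain ⟨g₀, hg₀⟩ := QuotientGroup.eq.1 h'
  obtain ⟨g, hg⟩ : ∃ g, σ * stdInvolution = MulAut.conj g * stdInvolution * σ := by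
    refine ⟨(stdInvolution * σ) g₀, ?_⟩
    rw [mul_assoc, ← aut_mul_conj, hg₀, mul_inv_cancel_left]
  have hg1 : g * stdInvolution g = 1 := by
    apply eq_one_of_conj_eq_one
    have hg' : σ * stdInvolution * σ⁻¹ = MulAut.conj g * stdInvolution := by
      rw [hg, mul_inv_cancel_right]
    have : (σ * stdInvolution * σ⁻¹) * (σ * stdInvolution * σ⁻¹) = 1 := by
      simp only [mul_assoc, inv_mul_cancel_left]
      rw [← mul_assoc stdInvolution, stdInvolution_mul_self, one_mul, mul_inv_cancel]
    rw [hg'] at this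
    rw [_root_.map_mul]
    calc MulAut.conj g * MulAut.conj (stdInvolution g)
        = MulAut.conj g * (MulAut.conj (stdInvolution g) * stdInvolution) * stdInvolution := by
          simp only [mul_assoc, stdInvolution_mul_self, mul_one]
      _ = 1 := by rw [← aut_mul_conj, ← this]; simp only [mul_assoc]
  obtain ⟨v, hv⟩ := exists_eq_mul_inv hg1
  have key : ∀ y, g = v * y * (stdInvolution v)⁻¹ → MulAut.conj v⁻¹ * σ * stdInvolution =
      MulAut.conj y * stdInvolution * (MulAut.conj v⁻¹ * σ) := by
    intro y hy
    have : MulAut.conj v⁻¹ * MulAut.conj g = MulAut.conj y * MulAut.conj (stdInvolution v⁻¹) := by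
      rw [← _root_.map_mul, ← _root_.map_mul, hy, _root_.map_inv]
      congr 1
      group
    rw [mul_assoc, hg, ← mul_assoc, ← mul_assoc, this, mul_assoc (MulAut.conj y), ← aut_mul_conj]
    simp only [mul_assoc]
  have hcomm : MulAut.conj v⁻¹ * σ * stdInvolution = stdInvolution * (MulAut.conj v⁻¹ * σ) := by
    rcases hv with hv | hv
    · have := key 1 (by rw [mul_one]; exact hv)
      rwa [_root_.map_one, one_mul] at this
    · exact absurd (key _ hv) (not_mul_stdInvolution_eq _)
  obtain ⟨a, ha⟩ := exists_zpow_conj_of_commute hcomm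
  refine ⟨a, IsConj.trans (isConj_iff.2 ⟨v⁻¹, ?_⟩) ha⟩
  simp

end FreeGroup

section Conjugacy

variable {G : Type*} [Group G] {t : G} {σ τ : MulAut G} {a b : ℤˣ}

theorem IsConj.zpow {x y : G} (h : IsConj x y) (n : ℤ) : IsConj (x ^ n) (y ^ n) := by
  obtain ⟨c, rfl⟩ := isConj_iff.1 h
  exact isConj_iff.2 ⟨c, by rw [conj_zpow]⟩

theorem isConj_mul_apply (hσ : IsConj (σ t) (t ^ (a : ℤ))) (hτ : IsConj (τ t) (t ^ (b : ℤ))) :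
    IsConj ((σ * τ) t) (t ^ ((a * b : ℤˣ) : ℤ)) := by
  have h := σ.toMonoidHom.map_isConj hτ
  have h' := hσ.zpow (b : ℤ)
  rw [← zpow_mul] at h'
  simp only [MulEquiv.coe_toMonoidHom, map_zpow] at h
  rw [Units.val_mul]
  exact h.trans h'

theorem isConj_inv_apply (hσ : IsConj (σ t) (t ^ (a : ℤ))) :
    IsConj (σ⁻¹ t) (t ^ (a : ℤ)) := by
  have h := (σ⁻¹.toMonoidHom.map_isConj hσ).zpow (a : ℤ)
  simp only [MulEquiv.coe_toMonoidHom, map_zpow, MulAut.inv_apply_self, ← zpow_mul] at h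
  rw [← Units.val_mul, Int.units_mul_self, Units.val_one, zpow_one] at h
  exact h.symm

open scoped commutatorElement in
theorem isConj_commutator_apply (hσ : IsConj (σ t) (t ^ (a : ℤ)))
    (hτ : IsConj (τ t) (t ^ (b : ℤ))) : IsConj (⁅σ, τ⁆ t) t := by
  have h := isConj_mul_apply (isConj_mul_apply (isConj_mul_apply hσ hτ) (isConj_inv_apply hσ))
    (isConj_inv_apply hτ)
  have hab : a * b * a * b = 1 := by
    rw [mul_right_comm a b a, Int.units_mul_self, one_mul, Int.units_mul_self]
  rw [hab, Units.val_one, zpow_one] at h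
  exact h

theorem toOut_mem_map_stabilizer {ρ : MulAut G} (h : IsConj (ρ t) t) :
    toOut ρ ∈ Subgroup.map toOut (MulAction.stabilizer (MulAut G) t) := by
  obtain ⟨c, hc⟩ := isConj_iff.1 h
  refine ⟨MulAut.conj c * ρ, ?_, ?_⟩
  · simpa [MulAction.mem_stabilizer_iff] using hc
  · have : toOut (MulAut.conj c) = 1 := (QuotientGroup.eq_one_iff _).2 ⟨c, rfl⟩
    rw [map_mul, this, one_mul]

end Conjugacy

end Centralizer

section LeastSubgroup

open Function

universe u

theorem Subgroup.mk_quotient_comap_le {G K : Type u} [Group G] [Group K] (φ : G →* K)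
    (H : Subgroup K) :
    Cardinal.mk (G ⧸ H.comap φ) ≤ Cardinal.mk (K ⧸ H) := by
  refine Cardinal.mk_le_of_injective
    (f := Quotient.lift (fun σ => (φ σ : K ⧸ H)) fun σ τ h => ?_) ?_
  · rw [← Quotient.eq_iff_equiv] at h
    have h' := QuotientGroup.eq.1 h
    exact QuotientGroup.eq.2 (by simpa using h')
  · rintro ⟨σ⟩ ⟨τ⟩ h
    exact QuotientGroup.eq.2 (by simpa using QuotientGroup.eq.1 h)

theorem countable_quotient_map_stabilizer {G : Type*} [Group G] [Countable G] (t : G) :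
    Countable (OutAut G ⧸ Subgroup.map toOut (MulAction.stabilizer (MulAut G) t)) := by
  have : Countable (MulAut G ⧸ MulAction.stabilizer (MulAut G) t) :=
    (MulAction.orbitEquivQuotientStabilizer (MulAut G) t).symm.injective.countable
  refine Surjective.countable (α := MulAut G ⧸ MulAction.stabilizer (MulAut G) t)
    (f := Quotient.lift (fun σ => ((toOut σ : OutAut G) :
    OutAut G ⧸ Subgroup.map toOut (MulAction.stabilizer (MulAut G) t))) fun σ τ h => ?_) ?_
  · rw [← Quotient.eq_iff_equiv] at h
    have h' := QuotientGroup.eq.1 h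
    exact QuotientGroup.eq.2 ⟨_, h', by simp⟩
  · rintro ⟨f⟩
    obtain ⟨σ, rfl⟩ := QuotientGroup.mk'_surjective (Inn G) f
    exact ⟨σ, rfl⟩

namespace FreeGroup

/-- The involution of `ℕ` which shifts the integers `1, …, r - 1` by `N`. -/
def shiftPerm (r N : ℕ) (h : r ≤ N) : Equiv.Perm ℕ :=
  Involutive.toPerm (fun i => if 0 < i ∧ i < r then i + N
    else if N < i ∧ i < N + r then i - N else i) (fun i => by
      dsimp only
      split_ifs <;> omega)

theorem shiftPerm_apply {r N : ℕ} (h : r ≤ N) (i : ℕ) : shiftPerm r N h i =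
    if 0 < i ∧ i < r then i + N else if N < i ∧ i < N + r then i - N else i :=
  rfl

theorem shiftPerm_inv {r N : ℕ} (h : r ≤ N) : (shiftPerm r N h)⁻¹ = shiftPerm r N h :=
  rfl

theorem freeGroupCongr_mul_stdInvolution {p : Equiv.Perm ℕ} (hp : p 0 = 0) :
    (freeGroupCongr p : MulAut (FreeGroup ℕ)) * stdInvolution =
      stdInvolution * (freeGroupCongr p : MulAut (FreeGroup ℕ)) :=
  mulAut_ext fun i => by
    rw [MulAut.mul_apply, MulAut.mul_apply, freeGroupCongr_apply_of]
    rcases eq_or_ne i 0 with rfl | h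
    · rw [hp, stdInvolution_of_zero, _root_.map_inv, freeGroupCongr_apply_of, hp]
    · rw [stdInvolution_of_ne h, freeGroupCongr_apply_of, stdInvolution_of_ne]
      rwa [← hp, p.injective.ne_iff]

open scoped commutatorElement in
theorem mem_of_index_lt_continuum {H : Subgroup (MulAut (FreeGroup ℕ))}
    (hH : Cardinal.mk (MulAut (FreeGroup ℕ) ⧸ H) < Cardinal.continuum)
    (hcomm : ∀ ρ ρ' : MulAut (FreeGroup ℕ), ρ * stdInvolution = stdInvolution * ρ →
      ρ' * stdInvolution = stdInvolution * ρ' → ⁅ρ, ρ'⁆ ∈ H)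
    {σ : MulAut (FreeGroup ℕ)} (hσ : σ (of 0) = of 0) : σ ∈ H := by
  obtain ⟨n, hn⟩ := exists_fixing_le_of_index_lt_continuum hH
  have hr : fixing (n + 1) ≤ H := fun τ hτ =>
    hn fun i hi => hτ i (hi.trans n.lt_succ_self)
  obtain ⟨N, hN, q, hq, hqN, -⟩ := exists_finitary_agreeing σ (n + 1)
  have hN2 : n + 1 ≤ 2 * N := by omega
  let ρ : MulAut (FreeGroup ℕ) := freeGroupCongr (shiftPerm (n + 1) N hN)
  let ρ' : MulAut (FreeGroup ℕ) := freeGroupCongr (shiftPerm (n + 1) (2 * N) hN2)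
  have hπ : ⁅ρ, ρ'⁆ ∈ H := hcomm _ _
    (freeGroupCongr_mul_stdInvolution (by simp [shiftPerm_apply]))
    (freeGroupCongr_mul_stdInvolution (by simp [shiftPerm_apply]))
  have happ : ∀ i < n + 1, ⁅ρ, ρ'⁆ (of i) = of (if i = 0 then 0 else i + N) := by
    intro i hi
    simp only [commutatorElement_def, MulAut.mul_apply, ρ, ρ']
    rw [freeGroupCongr_inv_apply_of, freeGroupCongr_inv_apply_of, freeGroupCongr_apply_of,
      freeGroupCongr_apply_of, shiftPerm_inv, shiftPerm_inv]
    congr 1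
    split_ifs with h0
    · simp [h0, shiftPerm_apply]
    · have h₁ : shiftPerm (n + 1) (2 * N) hN2 i = i + 2 * N := if_pos (by omega)
      have h₂ : shiftPerm (n + 1) N hN (i + 2 * N) = i + 2 * N :=
        (if_neg (by omega)).trans (if_neg (by omega))
      have h₃ : shiftPerm (n + 1) (2 * N) hN2 (i + 2 * N) = i :=
        (if_neg (by omega)).trans ((if_pos (by omega)).trans (by omega))
      have h₄ : shiftPerm (n + 1) N hN i = i + N := if_pos (by omega)
      rw [h₁, h₂, h₃, h₄]
  have hq' : ⁅ρ, ρ'⁆⁻¹ * (q * ⁅ρ, ρ'⁆) ∈ fixing (n + 1) := by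
    refine inv_mul_mem_fixing.2 fun i hi => ?_
    rw [MulAut.mul_apply, happ i hi]
    split_ifs with h0
    · rw [hq 0 n.succ_pos, hσ]
    · rw [hqN _ (by omega)]
  have hqH : q ∈ H := by
    have := mul_mem (mul_mem hπ (hr hq')) (inv_mem hπ)
    rwa [mul_inv_cancel_left, mul_inv_cancel_right] at this
  have := mul_mem hqH (hr (inv_mul_mem_fixing.2 hq))
  rwa [mul_inv_cancel_left] at this

theorem exists_aut_of_isBasis {B : Set (FreeGroup ℕ)} (hB : IsBasis B) {t : FreeGroup ℕ}
    (ht : t ∈ B) : ∃ Θ : MulAut (FreeGroup ℕ), Θ (of 0) = t ∧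
      ∀ i ≠ 0, Θ (of i) ∈ B ∧ Θ (of i) ≠ t := by
  let E : FreeGroup B ≃* FreeGroup ℕ := MulEquiv.ofBijective _ hB
  obtain ⟨e, he⟩ := exists_equiv_extending (r := 1) (Equiv.ofFreeGroupEquiv E) (fun _ => ⟨t, ht⟩)
    (fun _ => 0) (injective_of_subsingleton _) (injective_of_subsingleton _)
  have he0 : e.symm 0 = ⟨t, ht⟩ := e.symm_apply_eq.2 (he 0).symm
  have hΘ : ∀ i, (freeGroupCongr e.symm).trans E (of i) = e.symm i := fun i => by
    simp only [MulEquiv.trans_apply, freeGroupCongr_apply, map.of]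
    exact lift_apply_of
  refine ⟨(freeGroupCongr e.symm).trans E, ?_, fun i hi => ?_⟩
  · rw [hΘ, he0]
  · rw [hΘ]
    refine ⟨(e.symm i).2, fun h => hi ?_⟩
    rw [← e.symm.injective.eq_iff, he0]
    exact Subtype.ext h

end FreeGroup

end LeastSubgroup

/-- Let `F` be a free group of countably infinite rank, `t` a primitive element of `F`,
and `ψ ∈ Aut F` an extremal involution inverting `t`. Then the image in `Out F` of the
pointwise stabilizer `Γ_(t) = {σ ∈ Aut F : σt = t}` is the least subgroup of `Out F` of
index `< 2^ℵ₀` containing the commutator subgroup of the centralizer of `ψ̂` in `Out F`. -/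
theorem image_of_stabilizer_least_small_index_subgroup
    (t : FreeGroup ℕ)
    (ht : ∃ B : Set (FreeGroup ℕ), FreeGroup.IsBasis B ∧ t ∈ B)
    (ψ : MulAut (FreeGroup ℕ)) (hψ : IsInvolution ψ)
    (hext : ∃ B : Set (FreeGroup ℕ), FreeGroup.IsBasis B ∧ t ∈ B ∧ ψ t = t⁻¹ ∧
      ∀ b ∈ B, b ≠ t → ψ b = b)
    (T : Subgroup (OutAut (FreeGroup ℕ)))
    (hT : T = Subgroup.map toOut (MulAction.stabilizer (MulAut (FreeGroup ℕ)) t))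
    (Z : Subgroup (OutAut (FreeGroup ℕ)))
    (hZ : Z = Subgroup.centralizer {toOut ψ}) :
    (Cardinal.mk (OutAut (FreeGroup ℕ) ⧸ T) < Cardinal.continuum ∧ ⁅Z, Z⁆ ≤ T) ∧
    ∀ S : Subgroup (OutAut (FreeGroup ℕ)),
      Cardinal.mk (OutAut (FreeGroup ℕ) ⧸ S) < Cardinal.continuum → ⁅Z, Z⁆ ≤ S →
      T ≤ S := by
  subst hT hZ
  obtain ⟨B, hB, htB, hψt, hψB⟩ := hext
  obtain ⟨Θ, hΘt, hΘ⟩ := FreeGroup.exists_aut_of_isBasis hB htB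
  have hconj : Θ * FreeGroup.stdInvolution = ψ * Θ := FreeGroup.mulAut_ext fun i => by
    rw [MulAut.mul_apply, MulAut.mul_apply]
    rcases eq_or_ne i 0 with rfl | hi
    · rw [FreeGroup.stdInvolution_of_zero, map_inv, hΘt, hψt]
    · rw [FreeGroup.stdInvolution_of_ne hi, hψB _ (hΘ i hi).1 (hΘ i hi).2]
  have hψΘ : ψ = Θ * FreeGroup.stdInvolution * Θ⁻¹ := by rw [hconj, mul_inv_cancel_right]
  have hcent : ∀ σ : MulAut (FreeGroup ℕ), toOut σ ∈ Subgroup.centralizer {toOut ψ} →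
      ∃ a : ℤˣ, IsConj (σ t) (t ^ (a : ℤ)) := by
    intro σ hσ
    rw [Subgroup.mem_centralizer_singleton_iff] at hσ
    obtain ⟨a, ha⟩ := FreeGroup.exists_zpow_conj_of_toOut_commute (σ := Θ⁻¹ * σ * Θ) (by
      rw [hψΘ] at hσ
      simp only [map_mul, map_inv] at hσ ⊢
      rw [← mul_left_inj (toOut Θ)⁻¹, ← mul_right_inj (toOut Θ)]
      simpa [mul_assoc] using hσ)
    refine ⟨a, ?_⟩
    have := Θ.toMonoidHom.map_isConj ha
    simpa [hΘt] using this
  refine ⟨⟨?_, ?_⟩, fun S hS hZS => ?_⟩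
  · have := countable_quotient_map_stabilizer t
    exact Cardinal.mk_le_aleph0.trans_lt Cardinal.aleph0_lt_continuum
  · rw [Subgroup.commutator_le]
    intro f hf g hg
    obtain ⟨σ, rfl⟩ := QuotientGroup.mk'_surjective (Inn _) f
    obtain ⟨τ, rfl⟩ := QuotientGroup.mk'_surjective (Inn _) g
    obtain ⟨a, ha⟩ := hcent σ hf
    obtain ⟨b, hb⟩ := hcent τ hg
    have := toOut_mem_map_stabilizer (isConj_commutator_apply ha hb)
    rwa [map_commutatorElement] at this
  · rintro _ ⟨σ, hσ, rfl⟩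
    let φ : MulAut (FreeGroup ℕ) →* OutAut (FreeGroup ℕ) :=
      toOut.comp (MulAut.conj Θ).toMonoidHom
    have hφ : ∀ ρ, φ ρ = toOut (Θ * ρ * Θ⁻¹) := fun ρ => rfl
    have hindex : Cardinal.mk (MulAut (FreeGroup ℕ) ⧸ S.comap φ) < Cardinal.continuum := by
      have := Subgroup.mk_quotient_comap_le φ S
      exact this.trans_lt hS
    have hmem : ∀ ρ : MulAut (FreeGroup ℕ),
        ρ * FreeGroup.stdInvolution = FreeGroup.stdInvolution * ρ →
        φ ρ ∈ Subgroup.centralizer {toOut ψ} := by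
      intro ρ hρ
      have hψφ : toOut ψ = φ FreeGroup.stdInvolution := by rw [hφ, hψΘ]
      rw [Subgroup.mem_centralizer_singleton_iff, hψφ, ← map_mul, ← map_mul, hρ]
    have := FreeGroup.mem_of_index_lt_continuum (σ := Θ⁻¹ * σ * Θ) hindex
      (fun ρ ρ' hρ hρ' => by
        rw [Subgroup.mem_comap, map_commutatorElement]
        exact hZS (Subgroup.commutator_mem_commutator (hmem ρ hρ) (hmem ρ' hρ')))
      (by
        have hσt : σ t = t := hσ
        rw [MulAut.mul_apply, MulAut.mul_apply, hΘt, hσt, ← hΘt, MulAut.inv_apply_self])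
    rw [Subgroup.mem_comap, hφ] at this
    convert this using 2
    group
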